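/- Let d ≥ 2 and let σ be the permutation of {1,…,d} given by σ(i) = d+1−i. Then for Lebesgue-almost every x > 0, the interval exchange transformation T_σ(a(x)) with length vector a(x) = (x, x², …, x^d) is uniquely ergodic. -/

import Mathlib

open MeasureTheory Filter Set

/-- `partialSum d a i` is the point `x_i(a) = Σ_{j < i} a_j` (with `Fin d` zero-indexed, so
`i : ℕ` ranges over `0, …, d`). -/
noncomputable def partialSum (d : ℕ) (a : Fin d → ℝ) (i : ℕ) : ℝ :=
  ∑ j ∈ Finset.univ.filter (fun j : Fin d => (j : ℕ) < i), a j

/-- `partialSumPerm d σ a i` is the point `x'_i(a) = Σ_{j=1}^i a_{σ⁻¹(j)} = Σ_{j : σ j < i} a_j`. -/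
noncomputable def partialSumPerm (d : ℕ) (σ : Equiv.Perm (Fin d)) (a : Fin d → ℝ) (i : ℕ) : ℝ :=
  ∑ j ∈ Finset.univ.filter (fun j : Fin d => ((σ j : ℕ)) < i), a j

/-- The interval `I_a = [0, Σ_i a_i)`. -/
noncomputable def ietInterval (d : ℕ) (a : Fin d → ℝ) : Set ℝ :=
  Set.Ico 0 (partialSum d a d)

/-- The interval exchange transformation `T_σ(a)`: on the interval
`I_i = [x_{i-1}(a), x_i(a))` (zero-indexed: `[x_i, x_{i+1})` for `i : Fin d`) it translates by
`x'_{σ(i)-1}(a) - x_{i-1}(a)`.  Outside `I_a` it is (arbitrarily) the identity. -/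
noncomputable def iet (d : ℕ) (σ : Equiv.Perm (Fin d)) (a : Fin d → ℝ) (x : ℝ) : ℝ :=
  if h : ∃ i : Fin d, partialSum d a (i : ℕ) ≤ x ∧ x < partialSum d a ((i : ℕ) + 1) then
    x - partialSum d a ((h.choose : Fin d) : ℕ) + partialSumPerm d σ a ((σ h.choose : Fin d) : ℕ)
  else x

/-- `σ` is irreducible: no `k` with `1 ≤ k < d` such that `σ({1,…,k}) = {1,…,k}`. -/
def IETIrreducible (d : ℕ) (σ : Equiv.Perm (Fin d)) : Prop :=
  ∀ k : ℕ, 0 < k → k < d → ¬ (∀ i : Fin d, (i : ℕ) < k → (σ i : ℕ) < k)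

/-- The function `L_{a,b} : I_a → ℝ`, equal to `y_i(b) - y'_{σ(i)}(b)` on `I_i(a)`
(extended by `0` off `I_a`). -/
noncomputable def ietL (d : ℕ) (σ : Equiv.Perm (Fin d)) (a b : Fin d → ℝ) (x : ℝ) : ℝ :=
  if h : ∃ i : Fin d, partialSum d a (i : ℕ) ≤ x ∧ x < partialSum d a ((i : ℕ) + 1) then
    partialSum d b ((h.choose : ℕ) + 1) - partialSumPerm d σ b ((σ h.choose : ℕ) + 1)
  else 0

/-- A connection `(i,j,m)` of `T = T_σ(a)`: `i, j ∈ {0,…,d-1}`, `m > 0`, `T^m(x_i) = x_j`. -/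
def IsConnection (d : ℕ) (σ : Equiv.Perm (Fin d)) (a : Fin d → ℝ) (i j m : ℕ) : Prop :=
  i < d ∧ j < d ∧ 0 < m ∧ (iet d σ a)^[m] (partialSum d a i) = partialSum d a j

/-- `μ ∈ ℳ_a`: a non-atomic `T_σ(a)`-invariant Borel probability measure on `I_a`. -/
def IsIETInvariantMeasure (d : ℕ) (σ : Equiv.Perm (Fin d)) (a : Fin d → ℝ)
    (μ : Measure ℝ) : Prop :=
  IsProbabilityMeasure μ ∧ NoAtoms μ ∧ μ (ietInterval d a)ᶜ = 0 ∧
    Measure.map (iet d σ a) μ = μ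

/-- `(a,b)` is a positive pair. -/
def IsPositivePair (d : ℕ) (σ : Equiv.Perm (Fin d)) (a b : Fin d → ℝ) : Prop :=
  (∀ μ : Measure ℝ, IsIETInvariantMeasure d σ a μ → 0 < ∫ x, ietL d σ a b x ∂μ) ∧
  (∀ i j m : ℕ, IsConnection d σ a i j m →
    partialSum d b i - partialSum d b j <
      ∑ n ∈ Finset.range m, ietL d σ a b ((iet d σ a)^[n] (partialSum d a i)))

/-- `ε_n(a)`. -/
noncomputable def ietEps (d : ℕ) (σ : Equiv.Perm (Fin d)) (a : Fin d → ℝ) (n : ℕ) : ℝ :=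
  sInf { v : ℝ | ∃ i j k l : ℕ, 1 ≤ i ∧ i ≤ d - 1 ∧ 1 ≤ j ∧ j ≤ d - 1 ∧
    k ≤ n ∧ l ≤ n ∧ (i, k) ≠ (j, l) ∧
    v = |(iet d σ a)^[k] (partialSum d a i) - (iet d σ a)^[l] (partialSum d a j)| }

/-- `a` is of recurrence type: `limsup n ε_n(a) > 0`. -/
def OfRecurrenceType (d : ℕ) (σ : Equiv.Perm (Fin d)) (a : Fin d → ℝ) : Prop :=
  0 < Filter.limsup (fun n : ℕ => (n : ℝ) * ietEps d σ a n) Filter.atTop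

/-- `a` is of bounded type: `liminf n ε_n(a) > 0`. -/
def OfBoundedType (d : ℕ) (σ : Equiv.Perm (Fin d)) (a : Fin d → ℝ) : Prop :=
  0 < Filter.liminf (fun n : ℕ => (n : ℝ) * ietEps d σ a n) Filter.atTop

/-- The (topological) support of a measure on `ℝ`. -/
def measSupport (μ : Measure ℝ) : Set ℝ :=
  {x : ℝ | ∀ r : ℝ, 0 < r → 0 < μ (Set.Ioo (x - r) (x + r))}

/-- `μ` is a finite regular Borel measure on `ℝ` which is `(C,α)`-decaying and `D`-Federer. -/
def IsDecayingFederer (μ : Measure ℝ) (C α D : ℝ) : Prop :=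
  IsFiniteMeasure μ ∧ μ.Regular ∧
  ∀ x ∈ measSupport μ, ∀ ε r : ℝ, 0 < ε → ε < 1 → 0 < r → r < 1 →
    μ (Set.Ioo (x - ε * r) (x + ε * r)) ≤
      ENNReal.ofReal (C * ε ^ α) * μ (Set.Ioo (x - r) (x + r)) ∧
    μ (Set.Ioo (x - 3 * r) (x + 3 * r)) ≤
      ENNReal.ofReal D * μ (Set.Ioo (x - r) (x + r))

/-- `μ` is decaying and Federer: `(C,α)`-decaying and `D`-Federer for some `C, α, D > 0`. -/
def DecayingFederer (μ : Measure ℝ) : Prop :=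
  ∃ C α D : ℝ, 0 < C ∧ 0 < α ∧ 0 < D ∧ IsDecayingFederer μ C α D

/-- `T_σ(a)` is uniquely ergodic: the unique `T_σ(a)`-invariant Borel probability measure on
`I_a` is normalized Lebesgue measure. -/
def UniquelyErgodicIET (d : ℕ) (σ : Equiv.Perm (Fin d)) (a : Fin d → ℝ) : Prop :=
  ∀ μ : Measure ℝ, IsProbabilityMeasure μ → μ (ietInterval d a)ᶜ = 0 →
    Measure.map (iet d σ a) μ = μ →
    μ = (volume (ietInterval d a))⁻¹ • volume.restrict (ietInterval d a)

/-- `T` exchanges the `d` intervals `[b i, b (i + 1))` of `[0, b d)` by reversing their order. -/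
structure ReversingIET (d : ℕ) (b : ℕ → ℝ) (T : ℝ → ℝ) : Prop where
  pos : 1 ≤ d
  zero : b 0 = 0
  lt_succ : ∀ i < d, b i < b (i + 1)
  map_eq : ∀ i < d, ∀ y, b i ≤ y → y < b (i + 1) → T y = y - b i + (b d - b (i + 1))

/-- `y` is one of the interior endpoints `b 1, …, b (d - 1)`. -/
def IsBreak (d : ℕ) (b : ℕ → ℝ) (y : ℝ) : Prop := ∃ j, 1 ≤ j ∧ j < d ∧ y = b j

/-- The first `N` iterates of `T` are continuous on the open interval `(p, q)`. -/
def FreeIoo (d : ℕ) (b : ℕ → ℝ) (T : ℝ → ℝ) (p q : ℝ) (N : ℕ) : Prop :=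
  ∀ z, p < z → z < q → ∀ m < N, ¬ IsBreak d b (T^[m] z)

/-- The points of `[0, b d)` at which one of the first `N` iterates of `T` hits a break. -/
def hitSet (d : ℕ) (b : ℕ → ℝ) (T : ℝ → ℝ) (N : ℕ) : Set ℝ :=
  {y | 0 ≤ y ∧ y < b d ∧ ∃ m < N, IsBreak d b (T^[m] y)}

/-- A reversing exchange without connections and without periodic points. -/
structure GenericIET (d : ℕ) (b : ℕ → ℝ) (T : ℝ → ℝ) : Prop extends ReversingIET d b T where
  no_conn : ∀ l < d, ∀ j, 1 ≤ j → j < d → ∀ k, 1 ≤ k → T^[k] (b l) ≠ b j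
  no_per : ∀ y, 0 ≤ y → y < b d → ∀ q, 1 ≤ q → T^[q] y ≠ y

/-- Every point lies in an interval of length `R` on which `T^[N]` is continuous. -/
def FreeCover (d : ℕ) (b : ℕ → ℝ) (T : ℝ → ℝ) (N : ℕ) (R : ℝ) : Prop :=
  ∀ y, 0 ≤ y → y < b d →
    ∃ p, 0 ≤ p ∧ p ≤ y ∧ y < p + R ∧ p + R ≤ b d ∧ FreeIoo d b T p (p + R) N

namespace ReversingIET
variable {d : ℕ} {b : ℕ → ℝ} {T : ℝ → ℝ}

theorem lt_of_lt (h : ReversingIET d b T) {i j : ℕ} (hij : i < j) (hj : j ≤ d) : b i < b j := by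
  induction j with
  | zero => omega
  | succ j ih =>
    rcases Nat.lt_succ_iff_lt_or_eq.1 hij with h1 | rfl
    · exact (ih h1 (by omega)).trans (h.lt_succ j (by omega))
    · exact h.lt_succ _ (by omega)

theorem le_of_le (h : ReversingIET d b T) {i j : ℕ} (hij : i ≤ j) (hj : j ≤ d) : b i ≤ b j := by
  rcases hij.eq_or_lt with rfl | h1
  · exact le_rfl
  · exact (h.lt_of_lt h1 hj).le

theorem nonneg (h : ReversingIET d b T) {i : ℕ} (hi : i ≤ d) : 0 ≤ b i :=
  h.zero ▸ h.le_of_le (Nat.zero_le i) hi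

theorem pos_of (h : ReversingIET d b T) {i : ℕ} (h0 : 1 ≤ i) (hi : i ≤ d) : 0 < b i :=
  h.zero ▸ h.lt_of_lt h0 hi

theorem L_pos (h : ReversingIET d b T) : 0 < b d := h.pos_of h.pos le_rfl

theorem exists_idx (h : ReversingIET d b T) {y : ℝ} (h0 : 0 ≤ y) (h1 : y < b d) :
    ∃ i < d, b i ≤ y ∧ y < b (i + 1) := by
  have key : ∀ n, y < b n → ∃ i < n, b i ≤ y ∧ y < b (i + 1) := by
    intro n
    induction n with
    | zero => intro h2; rw [h.zero] at h2; linarith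
    | succ n ih =>
      intro h2
      by_cases h3 : y < b n
      · obtain ⟨i, hi, hh⟩ := ih h3
        exact ⟨i, by omega, hh⟩
      · exact ⟨n, by omega, not_lt.1 h3, h2⟩
  exact key d h1

theorem exists_idx' (h : ReversingIET d b T) {y : ℝ} (h0 : 0 < y) (h1 : y ≤ b d) :
    ∃ i < d, b i < y ∧ y ≤ b (i + 1) := by
  have key : ∀ n, y ≤ b n → ∃ i < n, b i < y ∧ y ≤ b (i + 1) := by
    intro n
    induction n with
    | zero => intro h2; rw [h.zero] at h2; linarith
    | succ n ih =>
      intro h2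
      by_cases h3 : y ≤ b n
      · obtain ⟨i, hi, hh⟩ := ih h3
        exact ⟨i, by omega, hh⟩
      · exact ⟨n, by omega, not_le.1 h3, h2⟩
  exact key d h1

theorem mapsTo (h : ReversingIET d b T) {y : ℝ} (h0 : 0 ≤ y) (h1 : y < b d) :
    0 ≤ T y ∧ T y < b d := by
  obtain ⟨i, hi, h2, h3⟩ := h.exists_idx h0 h1
  rw [h.map_eq i hi y h2 h3]
  have := h.le_of_le (show i + 1 ≤ d by omega) le_rfl
  have := h.nonneg (show i ≤ d by omega)
  constructor <;> linarith

theorem iterate_mem (h : ReversingIET d b T) {y : ℝ} (h0 : 0 ≤ y) (h1 : y < b d) (m : ℕ) :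
    0 ≤ T^[m] y ∧ T^[m] y < b d := by
  induction m with
  | zero => exact ⟨h0, h1⟩
  | succ m ih => rw [Function.iterate_succ_apply']; exact h.mapsTo ih.1 ih.2

theorem inj (h : ReversingIET d b T) {y z : ℝ} (h0 : 0 ≤ y) (h1 : y < b d) (h0' : 0 ≤ z)
    (h1' : z < b d) (he : T y = T z) : y = z := by
  wlog hyz : y ≤ z generalizing y z
  · exact (this h0' h1' h0 h1 he.symm (le_of_not_ge hyz)).symm
  obtain ⟨i, hi, h2, h3⟩ := h.exists_idx h0 h1
  obtain ⟨j, hj, h4, h5⟩ := h.exists_idx h0' h1'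
  rw [h.map_eq i hi y h2 h3, h.map_eq j hj z h4 h5] at he
  rcases lt_trichotomy i j with hij | rfl | hij
  · have := h.le_of_le (show i + 1 ≤ j by omega) (by omega)
    linarith
  · linarith
  · have := h.le_of_le (show j + 1 ≤ i by omega) (by omega)
    linarith

theorem iterate_inj (h : ReversingIET d b T) {y z : ℝ} (h0 : 0 ≤ y) (h1 : y < b d) (h0' : 0 ≤ z)
    (h1' : z < b d) (m : ℕ) (he : T^[m] y = T^[m] z) : y = z := by
  induction m with
  | zero => exact he
  | succ m ih =>
    rw [Function.iterate_succ_apply', Function.iterate_succ_apply'] at he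
    have hy := h.iterate_mem h0 h1 m
    have hz := h.iterate_mem h0' h1' m
    exact ih (h.inj hy.1 hy.2 hz.1 hz.2 he)

theorem surj (h : ReversingIET d b T) {z : ℝ} (h0 : 0 ≤ z) (h1 : z < b d) :
    ∃ y, 0 ≤ y ∧ y < b d ∧ T y = z := by
  obtain ⟨i, hi, h2, h3⟩ := h.exists_idx' (y := b d - z) (by linarith) (by linarith)
  have h4 := h.nonneg (show i ≤ d by omega)
  have h5 := h.le_of_le (show i + 1 ≤ d by omega) le_rfl
  have h6 : b i ≤ z + b i + b (i + 1) - b d := by linarith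
  have h7 : z + b i + b (i + 1) - b d < b (i + 1) := by linarith
  refine ⟨z + b i + b (i + 1) - b d, by linarith, by linarith, ?_⟩
  rw [h.map_eq i hi _ h6 h7]; ring

theorem iterate_surj (h : ReversingIET d b T) {z : ℝ} (h0 : 0 ≤ z) (h1 : z < b d) (m : ℕ) :
    ∃ y, 0 ≤ y ∧ y < b d ∧ T^[m] y = z := by
  induction m generalizing z with
  | zero => exact ⟨z, h0, h1, rfl⟩
  | succ m ih =>
    obtain ⟨y, hy0, hy1, hy⟩ := h.surj h0 h1
    obtain ⟨w, hw0, hw1, hw⟩ := ih hy0 hy1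
    exact ⟨w, hw0, hw1, by rw [Function.iterate_succ_apply', hw, hy]⟩

theorem map_b (h : ReversingIET d b T) {l : ℕ} (hl : l < d) : T (b l) = b d - b (l + 1) := by
  rw [h.map_eq l hl _ le_rfl (h.lt_succ l hl)]; ring

/-- `T` is a translation to the right of `y` as long as no break is met. -/
theorem map_add (h : ReversingIET d b T) {y w : ℝ} (h0 : 0 ≤ y) (hw : 0 ≤ w) (h1 : y + w < b d)
    (hb : ∀ z, y < z → z ≤ y + w → ¬ IsBreak d b z) : T (y + w) = T y + w := by
  obtain ⟨i, hi, h2, h3⟩ := h.exists_idx h0 (by linarith)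
  have h4 : y + w < b (i + 1) := by
    by_contra hc
    push Not at hc
    rcases Nat.lt_or_ge (i + 1) d with h5 | h5
    · exact hb _ h3 hc ⟨i + 1, by omega, h5, rfl⟩
    · have : i + 1 = d := by omega
      rw [this] at hc; linarith
  rw [h.map_eq i hi y h2 h3, h.map_eq i hi (y + w) (by linarith) h4]; ring

/-- The inverse of `T` is a translation as long as no `T (b l)` is met. -/
theorem map_add_inv (h : ReversingIET d b T) {y w : ℝ} (h0 : 0 ≤ y) (hy : y < b d) (hw : 0 ≤ w)
    (h1 : T y + w < b d)
    (hb : ∀ l < d, ¬ (T y < T (b l) ∧ T (b l) ≤ T y + w)) : y + w < b d ∧ T (y + w) = T y + w := by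
  obtain ⟨i, hi, h2, h3⟩ := h.exists_idx h0 hy
  have e1 := h.map_eq i hi y h2 h3
  have hTy := h.mapsTo h0 hy
  have h4 : y + w < b (i + 1) := by
    by_contra hc
    push Not at hc
    have hi0 : 1 ≤ i := by
      by_contra h5
      have : i = 0 := by omega
      subst this
      rw [h.zero] at e1
      linarith
    obtain ⟨i, rfl⟩ := Nat.exists_eq_add_of_le' hi0
    have e2 := h.map_b (show i < d by omega)
    exact hb i (by omega) ⟨by linarith, by linarith⟩
  have := h.le_of_le (show i + 1 ≤ d by omega) le_rfl
  refine ⟨by linarith, ?_⟩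
  rw [e1, h.map_eq i hi (y + w) (by linarith) h4]; ring

end ReversingIET

theorem FreeIoo.mono {d : ℕ} {b : ℕ → ℝ} {T : ℝ → ℝ} {p q p' q' : ℝ} {N N' : ℕ}
    (h : FreeIoo d b T p q N) (hp : p ≤ p') (hq : q' ≤ q) (hN : N' ≤ N) :
    FreeIoo d b T p' q' N' :=
  fun z h1 h2 m hm => h z (by linarith) (by linarith) m (by omega)

namespace ReversingIET
variable {d : ℕ} {b : ℕ → ℝ} {T : ℝ → ℝ}

theorem iterate_add (h : ReversingIET d b T) {p q : ℝ} {N : ℕ} (hp : 0 ≤ p) (hq : q ≤ b d)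
    (hF : FreeIoo d b T p q N) {m : ℕ} (hm : m ≤ N) {z : ℝ} (hz : p ≤ z) (hz' : z < q) :
    T^[m] z = T^[m] p + (z - p) := by
  induction m generalizing z with
  | zero => simp
  | succ m ih =>
    have ih' := fun z h1 h2 => @ih (by omega) z h1 h2
    rw [Function.iterate_succ_apply', Function.iterate_succ_apply', ih' z hz hz']
    have hmem := h.iterate_mem (y := z) (by linarith) (by linarith) m
    have hmem' := h.iterate_mem (y := p) hp (by linarith) m
    rw [ih' z hz hz'] at hmem
    refine h.map_add hmem'.1 (by linarith) hmem.2 fun u hu1 hu2 hbr => ?_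
    have e := ih' (u - T^[m] p + p) (by linarith) (by linarith)
    refine hF (u - T^[m] p + p) (by linarith) (by linarith) m (by omega) ?_
    rw [e]
    convert hbr using 1; ring

theorem iterate_add_le (h : ReversingIET d b T) {p q : ℝ} {N : ℕ} (hp : 0 ≤ p) (hq : q ≤ b d)
    (hpq : p < q) (hF : FreeIoo d b T p q N) {m : ℕ} (hm : m ≤ N) :
    T^[m] p + (q - p) ≤ b d := by
  by_contra hc
  push Not at hc
  have h0 := h.iterate_mem (y := p) hp (by linarith) m
  set z := b d - T^[m] p + p with hz
  have h1 : p ≤ z := by rw [hz]; linarith [h0.2]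
  have h2 : z < q := by rw [hz]; linarith
  have e := h.iterate_add hp hq hF hm h1 h2
  have := (h.iterate_mem (y := z) (by linarith) (by linarith) m).2
  rw [e, hz] at this
  linarith

theorem hitSet_finite (h : ReversingIET d b T) (N : ℕ) : (hitSet d b T N).Finite := by
  have : hitSet d b T N ⊆ ⋃ m ∈ Finset.range N, ⋃ j ∈ Finset.range d,
      {y | 0 ≤ y ∧ y < b d ∧ T^[m] y = b j} := by
    rintro y ⟨h0, h1, m, hm, j, hj1, hj, e⟩
    simp only [mem_iUnion, Finset.mem_range]
    exact ⟨m, hm, j, hj, h0, h1, e⟩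
  refine Set.Finite.subset ?_ this
  refine Set.Finite.biUnion (Finset.finite_toSet _) fun m _ =>
    Set.Finite.biUnion (Finset.finite_toSet _) fun j _ => ?_
  refine Set.Subsingleton.finite ?_
  rintro y ⟨h0, h1, e⟩ z ⟨h0', h1', e'⟩
  exact h.iterate_inj h0 h1 h0' h1' m (e.trans e'.symm)

theorem freeIoo_iff {p q : ℝ} {N : ℕ} (hp : 0 ≤ p) (hq : q ≤ b d) :
    FreeIoo d b T p q N ↔ ∀ z ∈ hitSet d b T N, ¬ (p < z ∧ z < q) := by
  constructor
  · rintro hF z ⟨-, -, m, hm, hb⟩ ⟨h1, h2⟩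
    exact hF z h1 h2 m hm hb
  · intro hF z h1 h2 m hm hb
    exact hF z ⟨by linarith, by linarith, m, hm, hb⟩ ⟨h1, h2⟩

end ReversingIET

/-- The endpoints of the exchanged intervals for the lengths `x, x ^ 2, …`. -/
noncomputable def powSum (x : ℝ) (i : ℕ) : ℝ := ∑ j ∈ Finset.range i, x ^ (j + 1)

theorem powSum_succ (x : ℝ) (i : ℕ) : powSum x (i + 1) = powSum x i + x ^ (i + 1) :=
  Finset.sum_range_succ _ _

theorem powSum_zero (x : ℝ) : powSum x 0 = 0 := Finset.sum_range_zero _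

theorem partialSum_pow {d : ℕ} (x : ℝ) {i : ℕ} (hi : i ≤ d) :
    partialSum d (fun i : Fin d => x ^ ((i : ℕ) + 1)) i = powSum x i := by
  unfold partialSum powSum
  rw [Finset.sum_filter,
    Fin.sum_univ_eq_sum_range (fun j => if j < i then x ^ (j + 1) else 0) d,
    ← Finset.sum_filter]
  congr 1
  ext j
  simp only [Finset.mem_filter, Finset.mem_range]
  omega

theorem partialSumPerm_pow {d : ℕ} (σ : Equiv.Perm (Fin d))
    (hσ : ∀ i : Fin d, (σ i : ℕ) = d - 1 - (i : ℕ)) (x : ℝ) (i : Fin d) :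
    partialSumPerm d σ (fun i : Fin d => x ^ ((i : ℕ) + 1)) (σ i) =
      powSum x d - powSum x ((i : ℕ) + 1) := by
  have hi := i.2
  unfold partialSumPerm powSum
  rw [Finset.sum_filter]
  simp only [hσ]
  rw [Fin.sum_univ_eq_sum_range (fun j => if d - 1 - j < d - 1 - i then x ^ (j + 1) else 0) d,
    ← Finset.sum_filter, eq_sub_iff_add_eq, ← Finset.sum_union]
  · congr 1
    ext j
    simp only [Finset.mem_union, Finset.mem_filter, Finset.mem_range]
    omega
  · rw [Finset.disjoint_left]
    intro j
    simp only [Finset.mem_filter, Finset.mem_range]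
    omega

theorem reversingIET_iet {d : ℕ} (hd : 2 ≤ d) (σ : Equiv.Perm (Fin d))
    (hσ : ∀ i : Fin d, (σ i : ℕ) = d - 1 - (i : ℕ)) {x : ℝ} (hx : 0 < x) :
    ReversingIET d (powSum x) (iet d σ (fun i : Fin d => x ^ ((i : ℕ) + 1))) := by
  have hlt : ∀ i, powSum x i < powSum x (i + 1) := fun i => by
    rw [powSum_succ]; have := pow_pos hx (i + 1); linarith
  have hmono : StrictMono (powSum x) := strictMono_nat_of_lt_succ hlt
  refine ⟨by omega, powSum_zero x, fun i _ => hlt i, ?_⟩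
  intro i hi y h1 h2
  have h : ∃ i : Fin d,
      partialSum d (fun i : Fin d => x ^ ((i : ℕ) + 1)) (i : ℕ) ≤ y ∧
        y < partialSum d (fun i : Fin d => x ^ ((i : ℕ) + 1)) ((i : ℕ) + 1) := by
    refine ⟨⟨i, hi⟩, ?_⟩
    rw [partialSum_pow x (by simp; omega), partialSum_pow x (by simp; omega)]
    exact ⟨h1, h2⟩
  have hc := h.choose_spec
  rw [partialSum_pow x (h.choose.2.le), partialSum_pow x h.choose.2] at hc
  have hci : (h.choose : ℕ) = i := by
    have h3 := hmono.lt_iff_lt.1 (hc.1.trans_lt h2)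
    have h4 := hmono.lt_iff_lt.1 (h1.trans_lt hc.2)
    omega
  rw [iet, dif_pos h, partialSum_pow x (h.choose.2.le), partialSumPerm_pow σ hσ, hci]

open Polynomial in
theorem exists_displacement {d : ℕ} (hd : 2 ≤ d) {x : ℝ} {T : ℝ → ℝ}
    (h : ReversingIET d (powSum x) T) (k : ℕ) {y : ℝ} (h0 : 0 ≤ y) (h1 : y < powSum x d) :
    ∃ Q : ℤ[X], T^[k] y = y + aeval x Q ∧ Q.coeff 1 ≤ 0 ∧
      (1 ≤ k → powSum x 1 ≤ y → Q.coeff 1 < 0) ∧ (Q.coeff 1 = 0 → Q.coeff 2 = k) := by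
  induction k generalizing y with
  | zero => exact ⟨0, by simp⟩
  | succ k ih =>
    obtain ⟨i, hi, h2, h3⟩ := h.exists_idx h0 h1
    have hT := h.mapsTo h0 h1
    obtain ⟨Q, e, q1, -, q2⟩ := ih hT.1 hT.2
    set S : ℕ → ℤ[X] := fun i => ∑ j ∈ Finset.range i, X ^ (j + 1) with hS
    have hSa : ∀ i, aeval x (S i) = powSum x i := fun i => by simp [hS, powSum]
    have hS1 : ∀ i, (S i).coeff 1 = if 1 ≤ i then 1 else 0 := fun i => by
      simp [hS, coeff_X_pow, Nat.one_le_iff_ne_zero, Nat.pos_iff_ne_zero]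
    have hS2 : ∀ i, (S i).coeff 2 = if 2 ≤ i then 1 else 0 := fun i => by
      have : ∀ j : ℕ, (2 = j + 1) ↔ 1 = j := by omega
      simp only [hS, finsetSum_coeff, coeff_X_pow, this, Finset.sum_ite_eq, Finset.mem_range]
      congr 1
    refine ⟨Q + (S d - S (i + 1) - S i), ?_, ?_, ?_, ?_⟩
    · rw [Function.iterate_succ_apply, e, h.map_eq i hi y h2 h3]
      simp only [map_add, map_sub, hSa]; ring
    · simp only [coeff_add, coeff_sub, hS1]
      split_ifs <;> omega
    · intro _ h4
      have : 1 ≤ i := by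
        by_contra hc
        have : i = 0 := by omega
        subst this
        exact absurd h3 (not_lt.2 h4)
      simp only [coeff_add, coeff_sub, hS1]
      split_ifs <;> omega
    · simp only [coeff_add, coeff_sub, hS1, hS2]
      push_cast
      split_ifs <;> omega

open Polynomial in
theorem ReversingIET.generic_of_transcendental {d : ℕ} (hd : 2 ≤ d) {x : ℝ} {T : ℝ → ℝ}
    (h : ReversingIET d (powSum x) T) (hx : Transcendental ℤ x) :
    GenericIET d (powSum x) T := by
  have hz : ∀ Q : ℤ[X], aeval x Q = 0 → Q = 0 := fun Q hQ =>
    (transcendental_iff.1 hx) Q hQ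
  refine ⟨h, ?_, ?_⟩
  · intro l hl j hj1 hj k hk he
    obtain ⟨Q, e, q1, q2, -⟩ := exists_displacement hd h k (h.nonneg hl.le) (h.lt_of_lt hl le_rfl)
    set S : ℕ → ℤ[X] := fun i => ∑ j ∈ Finset.range i, X ^ (j + 1) with hS
    have hSa : ∀ i, aeval x (S i) = powSum x i := fun i => by simp [hS, powSum]
    have hS1 : ∀ i, (S i).coeff 1 = if 1 ≤ i then 1 else 0 := fun i => by
      simp [hS, coeff_X_pow, Nat.one_le_iff_ne_zero, Nat.pos_iff_ne_zero]
    have h0 := hz (S l + Q - S j) (by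
      simp only [_root_.map_add, map_sub, hSa]; linarith)
    have h1 := congrArg (fun P => P.coeff 1) h0
    simp only [coeff_add, coeff_sub, hS1, coeff_zero, if_pos hj1] at h1
    by_cases hl1 : 1 ≤ l
    · have := q2 hk (h.le_of_le hl1 hl.le)
      rw [if_pos hl1] at h1
      omega
    · rw [if_neg hl1] at h1
      omega
  · intro y h0 h1 q hq he
    obtain ⟨Q, e, q1, q2, q3⟩ := exists_displacement hd h q h0 h1
    have := hz Q (by linarith)
    subst this
    simp only [coeff_zero, forall_const] at q3
    omega

theorem ae_transcendental : ∀ᵐ x ∂(volume : Measure ℝ), Transcendental ℤ x := by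
  have : {x : ℝ | IsAlgebraic ℤ x}.Countable := Algebraic.countable ℤ ℝ
  exact this.ae_notMem volume

theorem ReversingIET.map_restrict_volume {d : ℕ} {b : ℕ → ℝ} {T : ℝ → ℝ}
    (h : ReversingIET d b T) (hm : Measurable T) {n : ℕ} (hn : n ≤ d) :
    Measure.map T (volume.restrict (Ico 0 (b n))) = volume.restrict (Ico (b d - b n) (b d)) := by
  induction n with
  | zero => simp [h.zero]
  | succ n ih =>
    have h1 := h.nonneg (show n ≤ d by omega)
    have h2 := h.lt_succ n (by omega)
    rw [← Ico_union_Ico_eq_Ico h1 h2.le, ← Ico_union_Ico_eq_Ico (a := b d - b (n + 1))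
      (b := b d - b n) (c := b d) (by linarith) (by linarith),
      Measure.restrict_union (Ico_disjoint_Ico_same) measurableSet_Ico,
      Measure.restrict_union (Ico_disjoint_Ico_same) measurableSet_Ico,
      Measure.map_add _ _ hm, ih (by omega), add_comm]
    congr 1
    set c := b d - b (n + 1) - b n with hc
    have e1 : Measure.map T (volume.restrict (Ico (b n) (b (n + 1)))) =
        Measure.map (fun y => y + c) (volume.restrict (Ico (b n) (b (n + 1)))) := by
      refine Measure.map_congr ?_
      filter_upwards [ae_restrict_mem measurableSet_Ico] with y hy
      rw [h.map_eq n (by omega) y hy.1 hy.2, hc]; ring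
    rw [e1]
    have e2 : Ico (b n) (b (n + 1)) =
        (fun y => y + c) ⁻¹' Ico (b d - b (n + 1)) (b d - b n) := by
      ext y
      simp only [mem_Ico, mem_preimage, hc]
      constructor <;> rintro ⟨_, _⟩ <;> constructor <;> linarith
    rw [e2]
    exact ((measurePreserving_add_right volume c).restrict_preimage measurableSet_Ico).map_eq

theorem ReversingIET.measurePreserving {d : ℕ} {b : ℕ → ℝ} {T : ℝ → ℝ}
    (h : ReversingIET d b T) (hm : Measurable T) :
    MeasurePreserving T (volume.restrict (Ico 0 (b d))) (volume.restrict (Ico 0 (b d))) :=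
  ⟨hm, by rw [h.map_restrict_volume hm le_rfl, sub_self]⟩

theorem ReversingIET.measurable {d : ℕ} {b : ℕ → ℝ} {T : ℝ → ℝ}
    (h : ReversingIET d b T) (hout : ∀ y, ¬ (0 ≤ y ∧ y < b d) → T y = y) : Measurable T := by
  have : T = fun y => y + ∑ i ∈ Finset.range d,
      (Ico (b i) (b (i + 1))).indicator (fun _ => b d - b (i + 1) - b i) y := by
    funext y
    by_cases hy : 0 ≤ y ∧ y < b d
    · obtain ⟨i, hi, h2, h3⟩ := h.exists_idx hy.1 hy.2
      rw [Finset.sum_eq_single_of_mem i (Finset.mem_range.2 hi),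
        indicator_of_mem (show y ∈ Ico (b i) (b (i + 1)) from ⟨h2, h3⟩),
        h.map_eq i hi y h2 h3]
      · ring
      · intro j hj hji
        refine indicator_of_notMem ?_ _
        rintro ⟨h4, h5⟩
        have hj := Finset.mem_range.1 hj
        rcases lt_or_gt_of_ne hji with h6 | h6
        · linarith [h.le_of_le (show j + 1 ≤ i by omega) (by omega)]
        · linarith [h.le_of_le (show i + 1 ≤ j by omega) (by omega)]
    · rw [hout y hy, Finset.sum_eq_zero, add_zero]
      intro i hi
      have hi := Finset.mem_range.1 hi
      refine indicator_of_notMem ?_ _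
      rintro ⟨h4, h5⟩
      refine hy ⟨(h.nonneg hi.le).trans h4, h5.trans_le (h.le_of_le (by omega) le_rfl)⟩
  rw [this]
  exact measurable_id.add (Finset.measurable_fun_sum _ fun i _ =>
    measurable_const.indicator measurableSet_Ico)

theorem measurable_iet_pow {d : ℕ} (hd : 2 ≤ d) (σ : Equiv.Perm (Fin d))
    (hσ : ∀ i : Fin d, (σ i : ℕ) = d - 1 - (i : ℕ)) {x : ℝ} (hx : 0 < x) :
    Measurable (iet d σ (fun i : Fin d => x ^ ((i : ℕ) + 1))) := by
  have hr := reversingIET_iet hd σ hσ hx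
  refine hr.measurable fun y hy => ?_
  rw [iet, dif_neg]
  rintro ⟨i, h1, h2⟩
  rw [partialSum_pow x i.2.le] at h1
  rw [partialSum_pow x i.2] at h2
  exact hy ⟨(hr.nonneg i.2.le).trans h1, h2.trans_le (hr.le_of_le i.2 le_rfl)⟩

/-- The orbit of `b l` comes within `t` of `b j` from the left at time `k`, with no break at
distance less than `R` to the right of the orbit before time `k`. -/
def IsoRight (d : ℕ) (b : ℕ → ℝ) (T : ℝ → ℝ) (t R : ℝ) (l j k : ℕ) : Prop :=
  T^[k] (b l) ≤ b j ∧ b j - t ≤ T^[k] (b l) ∧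
    ∀ m < k, ∀ z, IsBreak d b z → ¬ (T^[m] (b l) < z ∧ z < T^[m] (b l) + R)

/-- The orbit of `b l` comes within `t` of `b j` from the right at time `k`, with no break at
distance less than `R` to the left of the orbit between times `1` and `k - 1`. -/
def IsoLeft (d : ℕ) (b : ℕ → ℝ) (T : ℝ → ℝ) (t R : ℝ) (l j k : ℕ) : Prop :=
  b j ≤ T^[k] (b l) ∧ T^[k] (b l) ≤ b j + t ∧
    ∀ m, 1 ≤ m → m < k → ∀ z, IsBreak d b z → ¬ (T^[m] (b l) - R < z ∧ z < T^[m] (b l))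

/-- The interval of length `w` to the right of `e` lies in `[0, b d)` and is free. -/
def FreeRight (d : ℕ) (b : ℕ → ℝ) (T : ℝ → ℝ) (N : ℕ) (e w : ℝ) : Prop :=
  e + w ≤ b d ∧ FreeIoo d b T e (e + w) N

/-- The interval of length `w` to the left of `e` lies in `[0, b d)` and is free. -/
def FreeLeft (d : ℕ) (b : ℕ → ℝ) (T : ℝ → ℝ) (N : ℕ) (e w : ℝ) : Prop :=
  0 ≤ e - w ∧ FreeIoo d b T (e - w) e N

namespace GenericIET
variable {d : ℕ} {b : ℕ → ℝ} {T : ℝ → ℝ}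

theorem break_sep (h : ReversingIET d b T) {R : ℝ} (hR : ∀ i < d, R ≤ b (i + 1) - b i) {y z : ℝ}
    (hy : IsBreak d b y) (hz : IsBreak d b z) (hyz : y < z) : R ≤ z - y := by
  obtain ⟨i, hi1, hi, rfl⟩ := hy
  obtain ⟨j, hj1, hj, rfl⟩ := hz
  rcases Nat.lt_or_ge i j with h1 | h1
  · linarith [hR i hi, h.le_of_le (show i + 1 ≤ j by omega) hj.le]
  · linarith [h.le_of_le h1 hi.le]

theorem break_lt_end (h : ReversingIET d b T) {R : ℝ} (hR : ∀ i < d, R ≤ b (i + 1) - b i) {y : ℝ}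
    (hy : IsBreak d b y) : y + R ≤ b d := by
  obtain ⟨i, hi1, hi, rfl⟩ := hy
  linarith [hR i hi, h.le_of_le (show i + 1 ≤ d by omega) le_rfl]

theorem not_break_before (h : GenericIET d b T) {e : ℝ} {n j m : ℕ}
    (hj1 : 1 ≤ j) (hj : j < d) (hn : T^[n] e = b j) (hm : m < n) : ¬ IsBreak d b (T^[m] e) := by
  rintro ⟨i, hi1, hi, he⟩
  refine h.no_conn i hi j hj1 hj (n - m) (by omega) ?_
  rw [← he, ← Function.iterate_add_apply, Nat.sub_add_cancel hm.le, hn]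

theorem freeIoo_across {p e q : ℝ} {n : ℕ} (h1 : FreeIoo d b T p e n) (h2 : FreeIoo d b T e q n)
    (h3 : ∀ m < n, ¬ IsBreak d b (T^[m] e)) : FreeIoo d b T p q n := by
  intro z hz1 hz2
  rcases lt_trichotomy z e with h | rfl | h
  · exact h1 z hz1 h
  · exact h3
  · exact h2 z h hz2

theorem pos_of_hit (h : GenericIET d b T) {e : ℝ} (h0 : 0 ≤ e) {n j : ℕ}
    (hj1 : 1 ≤ j) (hj : j < d) (hn : T^[n] e = b j) : 0 < e := by
  rcases h0.eq_or_lt with rfl | h1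
  · exfalso
    rcases Nat.eq_zero_or_pos n with rfl | hn0
    · have := h.pos_of hj1 hj.le
      simp at hn; linarith
    · exact h.no_conn 0 (by omega) j hj1 hj n hn0 (by rw [h.zero, hn])
  · exact h1

theorem freeLeft_of_freeRight (h : GenericIET d b T) {t R : ℝ} (ht : t ≤ R)
    (hR : ∀ i < d, R ≤ b (i + 1) - b i) {e : ℝ} (h0 : 0 ≤ e) (h1 : e < b d) {n j : ℕ}
    (hj1 : 1 ≤ j) (hj : j < d) (hn : T^[n] e = b j)
    (hiso : ∀ l < d, ∀ k, 1 ≤ k → k ≤ n + 1 → ¬ IsoRight d b T t R l j k)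
    (hfr : FreeRight d b T (n + 1) e R) : FreeLeft d b T (n + 1) e t := by
  by_contra hcon
  have he0 := h.pos_of_hit h0 hj1 hj hn
  have hfin : {y | (y = 0 ∨ y ∈ hitSet d b T (n + 1)) ∧ e - t < y ∧ y < e}.Finite := by
    refine ((h.hitSet_finite (n + 1)).insert 0).subset ?_
    rintro y ⟨hy, -⟩
    exact hy
  have hne : {y | (y = 0 ∨ y ∈ hitSet d b T (n + 1)) ∧ e - t < y ∧ y < e}.Nonempty := by
    by_contra hemp
    rw [not_nonempty_iff_eq_empty, eq_empty_iff_forall_notMem] at hemp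
    have h2 : 0 ≤ e - t := by
      by_contra hc
      exact hemp 0 ⟨Or.inl rfl, by linarith, he0⟩
    refine hcon ⟨h2, (ReversingIET.freeIoo_iff h2 h1.le).2 fun z hz hz' => ?_⟩
    exact hemp z ⟨Or.inr hz, hz'.1, hz'.2⟩
  obtain ⟨y, ⟨hy, hyt, hye⟩, hmax⟩ := hfin.exists_maximalFor id _ hne
  have hy0 : 0 ≤ y := by
    rcases hy with rfl | hy
    · exact le_rfl
    · exact hy.1
  have hF1 : FreeIoo d b T y e (n + 1) := by
    refine (ReversingIET.freeIoo_iff hy0 h1.le).2 fun z hz hz' => ?_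
    have := hmax ⟨Or.inr hz, by linarith [hz'.1], hz'.2⟩ hz'.1.le
    simp only [id] at this
    linarith [hz'.1]
  have hF : FreeIoo d b T y (e + R) n :=
    freeIoo_across (hF1.mono le_rfl le_rfl (by omega)) (hfr.2.mono le_rfl le_rfl (by omega))
      fun m hm => h.not_break_before hj1 hj hn hm
  have htr : ∀ m ≤ n, ∀ z, y ≤ z → z < e + R → T^[m] z = T^[m] y + (z - y) :=
    fun m hm z hz hz' => h.iterate_add hy0 hfr.1 hF hm hz hz'
  have hRt : 0 < R := by linarith
  have htn := htr n le_rfl e hye.le (by linarith)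
  obtain ⟨m, hmn, l, hl, hml⟩ : ∃ m ≤ n, ∃ l < d, T^[m] y = b l ∧
      (m = n → IsBreak d b (b l) ∨ n = 0 ∧ l = 0) := by
    rcases hy with rfl | ⟨-, -, m, hm, l, hl1, hl, hml⟩
    · exact ⟨0, by omega, 0, by omega, h.zero.symm, fun h => Or.inr ⟨h.symm, rfl⟩⟩
    · exact ⟨m, by omega, l, hl, hml, fun _ => Or.inl ⟨l, hl1, hl, rfl⟩⟩
  have hmn' : m < n := by
    refine lt_of_le_of_ne hmn fun hmn' => ?_
    rcases hml.2 hmn' with hb | ⟨rfl, rfl⟩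
    · subst hmn'
      rw [hml.1] at htn
      have := break_sep h.toReversingIET hR hb ⟨j, hj1, hj, rfl⟩ (by linarith)
      linarith
    · have h3 := hR 0 (by omega)
      have h4 := h.le_of_le hj1 hj.le
      rw [hmn'] at hml
      simp only [Function.iterate_zero, id] at hml hn htn
      rw [h.zero] at *
      linarith
  refine hiso l hl (n - m) (by omega) (by omega) ?_
  have hit : ∀ i, T^[i] (b l) = T^[i + m] y := fun i => by
    rw [← hml.1, ← Function.iterate_add_apply]
  refine ⟨?_, ?_, ?_⟩
  · rw [hit, Nat.sub_add_cancel hmn]; linarith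
  · rw [hit, Nat.sub_add_cancel hmn]; linarith
  · rintro i hi z hz ⟨hz1, hz2⟩
    rw [hit] at hz1 hz2
    have := htr (i + m) (by omega) (y + (z - T^[i + m] y)) (by linarith) (by linarith)
    refine hF (y + (z - T^[i + m] y)) (by linarith) (by linarith) (i + m) (by omega) ?_
    rw [this]
    convert hz using 1
    ring

theorem freeRight_of_freeLeft (h : GenericIET d b T) {t R : ℝ} (ht : t ≤ R)
    (hR : ∀ i < d, R ≤ b (i + 1) - b i) {e : ℝ} (h0 : 0 ≤ e) (h1 : e < b d) {n j : ℕ}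
    (hj1 : 1 ≤ j) (hj : j < d) (hn : T^[n] e = b j)
    (hiso : ∀ l < d, ∀ k, 1 ≤ k → k ≤ n + 1 → ¬ IsoLeft d b T t R l j k)
    (hfl : FreeLeft d b T (n + 1) e R) : FreeRight d b T (n + 1) e t := by
  by_contra hcon
  have hfin : {y | (y = b d ∨ y ∈ hitSet d b T (n + 1)) ∧ e < y ∧ y < e + t}.Finite := by
    refine ((h.hitSet_finite (n + 1)).insert (b d)).subset ?_
    rintro y ⟨hy, -⟩
    exact hy
  have hne : {y | (y = b d ∨ y ∈ hitSet d b T (n + 1)) ∧ e < y ∧ y < e + t}.Nonempty := by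
    by_contra hemp
    rw [not_nonempty_iff_eq_empty, eq_empty_iff_forall_notMem] at hemp
    have h2 : e + t ≤ b d := by
      by_contra hc
      exact hemp (b d) ⟨Or.inl rfl, h1, by linarith⟩
    refine hcon ⟨h2, (ReversingIET.freeIoo_iff h0 h2).2 fun z hz hz' => ?_⟩
    exact hemp z ⟨Or.inr hz, hz'.1, hz'.2⟩
  obtain ⟨y, ⟨hy, hye, hyt⟩, hmin⟩ := hfin.exists_minimalFor id _ hne
  have hyL : y ≤ b d := by
    rcases hy with rfl | hy
    · exact le_rfl
    · exact hy.2.1.le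
  have hF1 : FreeIoo d b T e y (n + 1) := by
    refine (ReversingIET.freeIoo_iff h0 hyL).2 fun z hz hz' => ?_
    have := hmin ⟨Or.inr hz, hz'.1, by linarith [hz'.2]⟩ hz'.2.le
    simp only [id] at this
    linarith [hz'.2]
  have hF : FreeIoo d b T (e - R) y n :=
    freeIoo_across (hfl.2.mono le_rfl le_rfl (by omega)) (hF1.mono le_rfl le_rfl (by omega))
      fun m hm => h.not_break_before hj1 hj hn hm
  have hRt : 0 < R := by linarith
  have htr : ∀ m ≤ n, ∀ z, e - R ≤ z → z < y → T^[m] z = T^[m] e + (z - e) := by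
    intro m hm z hz hz'
    have e1 := h.iterate_add hfl.1 hyL hF hm hz hz'
    have e2 := h.iterate_add hfl.1 hyL hF hm (z := e) (by linarith) hye
    linarith
  set w := y - e with hw
  have hw0 : 0 < w := by linarith
  have hbj : IsBreak d b (b j) := ⟨j, hj1, hj, rfl⟩
  have hend := break_lt_end h.toReversingIET hR hbj
  have hS : ∀ i ≤ n, T^[n - i] e + w < b d ∧
      ∀ s ≤ i, T^[s] (T^[n - i] e + w) = T^[n - i + s] e + w := by
    intro i
    induction i with
    | zero =>
      intro _
      refine ⟨by rw [Nat.sub_zero, hn]; linarith, fun s hs => ?_⟩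
      have : s = 0 := by omega
      subst this; rfl
    | succ i ih =>
      intro hi
      obtain ⟨ih1, ih2⟩ := ih (by omega)
      set m := n - (i + 1) with hm
      have hmi : n - i = m + 1 := by omega
      rw [hmi] at ih1 ih2
      have hmem := h.iterate_mem h0 h1 m
      have hTm : T (T^[m] e) = T^[m + 1] e := (Function.iterate_succ_apply' T m e).symm
      have key := h.map_add_inv (y := T^[m] e) (w := w) hmem.1 hmem.2 hw0.le
        (by rw [hTm]; exact ih1) ?_
      · refine ⟨key.1, fun s hs => ?_⟩
        rcases s with _ | s
        · rfl
        · rw [Function.iterate_succ_apply, key.2, hTm, ih2 s (by omega)]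
          congr 2; omega
      · rintro l hl ⟨hl1, hl2⟩
        rw [hTm] at hl1 hl2
        rcases hl2.eq_or_lt with heq | hlt
        · refine hiso l hl (i + 1) (by omega) (by omega) ?_
          have hit : ∀ r ≤ i, T^[r + 1] (b l) = T^[m + 1 + r] e + w := fun r hr => by
            rw [Function.iterate_succ_apply, heq, ih2 r hr]
          have hni : m + 1 + i = n := by omega
          refine ⟨?_, ?_, ?_⟩
          · rw [hit i le_rfl, hni, hn]; linarith
          · rw [hit i le_rfl, hni, hn]; linarith
          · rintro r hr1 hr z hz ⟨hz1, hz2⟩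
            obtain ⟨r, rfl⟩ := Nat.exists_eq_add_of_le' hr1
            rw [hit r (by omega)] at hz1 hz2
            have := htr (m + 1 + r) (by omega) (e + (z - T^[m + 1 + r] e)) (by linarith)
              (by linarith)
            refine hF (e + (z - T^[m + 1 + r] e)) (by linarith) (by linarith) (m + 1 + r)
              (by omega) ?_
            rw [this]
            convert hz using 1
            ring
        · set s := T (b l) - T^[m + 1] e with hs
          have e1 := htr (m + 1) (by omega) (e + s) (by linarith) (by linarith)
          have e2 := htr m (by omega) (e + s) (by linarith) (by linarith)
          have e3 : T (T^[m] (e + s)) = T (b l) := by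
            rw [← Function.iterate_succ_apply' T m, e1, hs]; ring
          have hmem2 := h.iterate_mem (y := e + s) (by linarith) (by linarith) m
          have e4 := h.inj hmem2.1 hmem2.2 (h.nonneg hl.le) (h.lt_of_lt hl le_rfl) e3
          rcases Nat.eq_zero_or_pos l with rfl | hl0
          · rw [h.zero] at e4; linarith [hmem.1]
          · exact hF1 (e + s) (by linarith) (by linarith) m (by omega) ⟨l, hl0, hl, e4⟩
  obtain ⟨hS1, hS2⟩ := hS n le_rfl
  simp only [Nat.sub_self, Function.iterate_zero, id, Nat.zero_add] at hS1 hS2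
  have hey : e + w = y := by rw [hw]; ring
  rw [hey] at hS1 hS2
  rcases hy with hy | ⟨-, -, m, hm, j', hj'1, hj', hmj⟩
  · linarith
  · have e1 := hS2 m (by omega)
    rcases Nat.lt_or_ge m n with hmn | hmn
    · have e2 := hS2 (m + 1) (by omega)
      rw [Function.iterate_succ_apply', hmj] at e2
      refine hiso j' hj' (n - m) (by omega) (by omega) ?_
      have hit : ∀ i, T^[i] (b j') = T^[m + i] y := fun i => by
        rw [← hmj, ← Function.iterate_add_apply, add_comm]
      have hnm : m + (n - m) = n := by omega
      refine ⟨?_, ?_, ?_⟩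
      · rw [hit, hnm, hS2 n le_rfl, hn]; linarith
      · rw [hit, hnm, hS2 n le_rfl, hn]; linarith
      · rintro r hr1 hr z hz ⟨hz1, hz2⟩
        rw [hit, hS2 _ (by omega)] at hz1 hz2
        have := htr (m + r) (by omega) (e + (z - T^[m + r] e)) (by linarith)
              (by linarith)
        refine hF (e + (z - T^[m + r] e)) (by linarith) (by linarith) (m + r)
              (by omega) ?_
        rw [this]
        convert hz using 1
        ring
    · have : m = n := by omega
      subst this
      rw [hmj, hn] at e1
      have := break_sep h.toReversingIET hR hbj ⟨j', hj'1, hj', rfl⟩ (by linarith)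
      linarith

end GenericIET

/-- The union of the free intervals of length `R` in `[0, b d)`. -/
def freeUnion (d : ℕ) (b : ℕ → ℝ) (T : ℝ → ℝ) (N : ℕ) (R : ℝ) : Set ℝ :=
  {y | ∃ p, 0 ≤ p ∧ p ≤ y ∧ y < p + R ∧ p + R ≤ b d ∧ FreeIoo d b T p (p + R) N}

/-- Near the break preimages, being free at scale `t` implies being free at scale `R`. -/
def FreeStable (d : ℕ) (b : ℕ → ℝ) (T : ℝ → ℝ) (n : ℕ) (t R : ℝ) : Prop :=
  ∀ j, 1 ≤ j → j < d → ∀ e, 0 ≤ e → e < b d → T^[n] e = b j →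
    (FreeRight d b T (n + 1) e t → FreeRight d b T (n + 1) e R) ∧
    (FreeLeft d b T (n + 1) e t → FreeLeft d b T (n + 1) e R)

/-- No isolated hits up to time `N`. -/
def NoIso (d : ℕ) (b : ℕ → ℝ) (T : ℝ → ℝ) (N : ℕ) (t R : ℝ) : Prop :=
  ∀ l < d, ∀ j, 1 ≤ j → j < d → ∀ k, 1 ≤ k → k ≤ N →
    ¬ IsoRight d b T t R l j k ∧ ¬ IsoLeft d b T t R l j k

namespace GenericIET
variable {d : ℕ} {b : ℕ → ℝ} {T : ℝ → ℝ}

theorem mapsTo_freeUnion (h : GenericIET d b T) {t R : ℝ} (ht : 0 < t) (htR : 2 * t ≤ R)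
    (hR : ∀ i < d, R ≤ b (i + 1) - b i) {n : ℕ} (hst : FreeStable d b T n t R)
    (hiso : NoIso d b T (n + 1) t R) {y : ℝ} (hy : y ∈ freeUnion d b T (n + 1) R) :
    T y ∈ freeUnion d b T (n + 1) R := by
  obtain ⟨p, hp0, hpy, hyp, hpL, hF⟩ := hy
  have hR0 : 0 < R := by linarith
  have hpmem := h.mapsTo hp0 (by linarith)
  have htr : ∀ m ≤ n + 1, ∀ z, p ≤ z → z < p + R → T^[m] z = T^[m] p + (z - p) :=
    fun m hm z hz hz' => h.iterate_add hp0 hpL hF hm hz hz'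
  have hTy : T y = T p + (y - p) := htr 1 (by omega) y hpy hyp
  have hTpL : T p + R ≤ b d := by
    have := h.iterate_add_le hp0 hpL (by linarith) hF (m := 1) (by omega)
    simp only [Function.iterate_one] at this
    linarith
  have hF1 : FreeIoo d b T (T p) (T p + R) n := by
    intro z hz1 hz2 m hm
    have e1 := htr 1 (by omega) (z - T p + p) (by linarith) (by linarith)
    simp only [Function.iterate_one] at e1
    have e2 : T (z - T p + p) = z := by rw [e1]; ring
    have := hF (z - T p + p) (by linarith) (by linarith) (m + 1) (by omega)
    rwa [Function.iterate_succ_apply, e2] at this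
  by_cases hfree : FreeIoo d b T (T p) (T p + R) (n + 1)
  · exact ⟨T p, hpmem.1, by linarith, by linarith, hTpL, hfree⟩
  · unfold FreeIoo at hfree
    push Not at hfree
    obtain ⟨e, he1, he2, m, hm, hb⟩ := hfree
    have hmn : m = n := by
      by_contra hc
      exact hF1 e he1 he2 m (by omega) hb
    subst hmn
    have htr1 := fun z hz hz' => h.iterate_add hpmem.1 hTpL hF1 (le_refl m) (z := z) hz hz'
    have huniq : ∀ z, T p < z → z < T p + R → z ≠ e → ∀ i < m + 1, ¬ IsBreak d b (T^[i] z) := by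
      intro z hz1 hz2 hne i hi hbi
      have him : i = m := by
        by_contra hc
        exact hF1 z hz1 hz2 i (by omega) hbi
      subst him
      have e1 := htr1 z hz1.le hz2
      have e2 := htr1 e he1.le he2
      rcases lt_or_gt_of_ne hne with hlt | hlt
      · have := break_sep h.toReversingIET hR hbi hb (by linarith)
        linarith
      · have := break_sep h.toReversingIET hR hb hbi (by linarith)
        linarith
    obtain ⟨j, hj1, hj, hej⟩ := hb
    have he0 : 0 ≤ e := by linarith
    have heL : e < b d := by linarith
    have hboth : FreeRight d b T (m + 1) e R ∧ FreeLeft d b T (m + 1) e R := by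
      obtain ⟨hs1, hs2⟩ := hst j hj1 hj e he0 heL hej
      rcases le_total (R / 2) (e - T p) with hc | hc
      · have h1 : FreeLeft d b T (m + 1) e t :=
          ⟨by linarith, fun z hz1 hz2 => huniq z (by linarith) (by linarith) hz2.ne⟩
        exact ⟨hs1 (h.freeRight_of_freeLeft (by linarith) hR he0 heL hj1 hj hej
          (fun l hl k hk hk' => (hiso l hl j hj1 hj k hk hk').2) (hs2 h1)), hs2 h1⟩
      · have h1 : FreeRight d b T (m + 1) e t :=
          ⟨by linarith, fun z hz1 hz2 => huniq z (by linarith) (by linarith) hz1.ne'⟩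
        exact ⟨hs1 h1, hs2 (h.freeLeft_of_freeRight (by linarith) hR he0 heL hj1 hj hej
          (fun l hl k hk hk' => (hiso l hl j hj1 hj k hk hk').1) (hs1 h1))⟩
    rcases lt_or_ge (T y) e with hlt | hge
    · exact ⟨e - R, hboth.2.1, by linarith, by linarith, by linarith,
        hboth.2.2.mono le_rfl (by linarith) le_rfl⟩
    · exact ⟨e, he0, hge, by linarith, hboth.1.1, hboth.1.2⟩

theorem freeUnion_right_open {N : ℕ} {R : ℝ} {y : ℝ} (hy : 0 ≤ y) :
    ∃ ε > 0, ∀ z, y ≤ z → z < y + ε → (z ∈ freeUnion d b T N R ↔ y ∈ freeUnion d b T N R) := by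
  by_cases hO : y ∈ freeUnion d b T N R
  · obtain ⟨p, hp0, hpy, hyp, hpL, hF⟩ := hO
    refine ⟨p + R - y, by linarith, fun z hz hz' => ?_⟩
    exact ⟨fun _ => ⟨p, hp0, hpy, hyp, hpL, hF⟩,
      fun _ => ⟨p, hp0, by linarith, by linarith, hpL, hF⟩⟩
  · by_contra hcon
    push Not at hcon
    have key : ∀ ε > 0, ∃ p, y < p ∧ p < y + ε ∧ p + R ≤ b d ∧
        FreeIoo d b T p (p + R) N ∧ 0 < R := by
      intro ε hε
      obtain ⟨z, hz1, hz2, hz3⟩ := hcon ε hε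
      simp only [hO, and_false, not_false_eq_true, and_true, or_false] at hz3
      obtain ⟨p, hp0, hpz, hzp, hpL, hF⟩ := hz3
      refine ⟨p, ?_, by linarith, hpL, hF, by linarith⟩
      by_contra hc
      exact hO ⟨p, hp0, not_lt.1 hc, by linarith, hpL, hF⟩
    obtain ⟨p, hp1, -, hp3, -, hR0⟩ := key 1 one_pos
    refine hO ⟨y, hy, le_rfl, by linarith, by linarith, fun z hz1 hz2 => ?_⟩
    obtain ⟨p, hp1, hp2, -, hF, -⟩ := key (z - y) (by linarith)
    exact hF z (by linarith) (by linarith)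

theorem mem_freeUnion_of_map (h : ReversingIET d b T) (hm : Measurable T) {N : ℕ} {R : ℝ}
    (hinv : ∀ y ∈ freeUnion d b T N R, T y ∈ freeUnion d b T N R) {y : ℝ} (hy : 0 ≤ y)
    (hyL : y < b d) (hTy : T y ∈ freeUnion d b T N R) : y ∈ freeUnion d b T N R := by
  by_contra hO
  obtain ⟨ε, hε, hε'⟩ := freeUnion_right_open (d := d) (b := b) (T := T) (N := N) (R := R) hy
  obtain ⟨ε₂, hε₂, hε₂'⟩ := freeUnion_right_open (d := d) (b := b) (T := T) (N := N) (R := R)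
    (h.mapsTo hy hyL).1
  obtain ⟨i, hi, h2, h3⟩ := h.exists_idx hy hyL
  set δ := min (min ε ε₂) (b (i + 1) - y) with hδ
  have hδ0 : 0 < δ := lt_min (lt_min hε hε₂) (by linarith)
  have hδ1 : δ ≤ ε := (min_le_left _ _).trans (min_le_left _ _)
  have hδ2 : δ ≤ ε₂ := (min_le_left _ _).trans (min_le_right _ _)
  have hδ3 : δ ≤ b (i + 1) - y := min_le_right _ _
  have hbL := h.le_of_le (show i + 1 ≤ d by omega) le_rfl
  have hnot : ∀ z ∈ Ico y (y + δ), z ∉ freeUnion d b T N R := fun z hz =>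
    fun hz' => hO ((hε' z hz.1 (by linarith [hz.2])).1 hz')
  have hin : ∀ z ∈ Ico y (y + δ), T z ∈ freeUnion d b T N R := by
    intro z hz
    refine (hε₂' (T z) ?_ ?_).2 hTy <;>
    · rw [h.map_eq i hi y h2 h3, h.map_eq i hi z (by linarith [hz.1]) (by linarith [hz.2])]
      linarith [hz.1, hz.2]
  have hpos : (volume.restrict (Ico 0 (b d))) (Ico y (y + δ)) ≠ 0 := by
    rw [Measure.restrict_apply measurableSet_Ico, inter_eq_self_of_subset_left]
    · simp [hδ0]
    · exact fun z hz => ⟨by linarith [hz.1], by linarith [hz.2]⟩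
  obtain ⟨z, hz, m, hm0, hmz⟩ := (h.measurePreserving hm).conservative.exists_mem_iterate_mem
    measurableSet_Ico.nullMeasurableSet hpos
  obtain ⟨m, rfl⟩ := Nat.exists_eq_succ_of_ne_zero hm0
  have : ∀ m, T^[m + 1] z ∈ freeUnion d b T N R := by
    intro m
    induction m with
    | zero => exact hin z hz
    | succ m ih => rw [Function.iterate_succ_apply']; exact hinv _ ih
  exact hnot _ hmz (this m)

/-- `e` is a left-boundary point of the set `O`, seen from the right-open side. -/
def IsSwitch (L : ℝ) (O : Set ℝ) (e : ℝ) : Prop :=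
  0 < e ∧ e < L ∧ ∀ ε > 0, ∃ z, 0 ≤ z ∧ e - ε < z ∧ z < e ∧ (z ∈ O ↔ e ∉ O)

theorem exists_isSwitch {L : ℝ} {O : Set ℝ}
    (hopen : ∀ y, 0 ≤ y → ∃ ε > 0, ∀ z, y ≤ z → z < y + ε → (z ∈ O ↔ y ∈ O)) {u v : ℝ}
    (hu : 0 ≤ u) (huv : u < v) (hv : v < L) (hne : u ∈ O ↔ v ∉ O) : ∃ e, IsSwitch L O e := by
  set S := {s | u ≤ s ∧ s ≤ v ∧ ∀ z, u ≤ z → z ≤ s → (z ∈ O ↔ u ∈ O)} with hS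
  have huS : u ∈ S := ⟨le_rfl, huv.le, fun z h1 h2 => by rw [le_antisymm h2 h1]⟩
  have hbdd : BddAbove S := ⟨v, fun s hs => hs.2.1⟩
  set e := sSup S with he
  have hue : u ≤ e := le_csSup hbdd huS
  have hev : e ≤ v := csSup_le ⟨u, huS⟩ fun s hs => hs.2.1
  have hbelow : ∀ z, u ≤ z → z < e → (z ∈ O ↔ u ∈ O) := by
    intro z hz hze
    obtain ⟨s, hs, hzs⟩ := exists_lt_of_lt_csSup ⟨u, huS⟩ hze
    exact hs.2.2 z hz hzs.le
  have hediff : ¬ (e ∈ O ↔ u ∈ O) := by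
    intro hc
    have hev' : e < v := by
      refine lt_of_le_of_ne hev fun h => ?_
      rw [h] at hc; tauto
    obtain ⟨ε, hε, hε'⟩ := hopen e (by linarith)
    set s := min v (e + ε / 2)
    have hs1 : e < s := lt_min hev' (by linarith)
    have hs2 : s ≤ e + ε / 2 := min_le_right _ _
    have : s ∈ S := by
      refine ⟨by linarith, min_le_left _ _, fun z hz hzs => ?_⟩
      rcases lt_or_ge z e with h1 | h1
      · exact hbelow z hz h1
      · rw [hε' z h1 (by linarith)]; exact hc
    linarith [le_csSup hbdd this]
  have hue' : u < e := by
    refine lt_of_le_of_ne hue fun h => hediff ?_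
    rw [← h]
  refine ⟨e, by linarith, by linarith, fun ε hε => ?_⟩
  refine ⟨max u (e - ε / 2), by positivity, ?_, ?_, ?_⟩
  · exact lt_of_lt_of_le (by linarith) (le_max_right _ _)
  · exact max_lt hue' (by linarith)
  · rw [hbelow _ (le_max_left _ _) (max_lt hue' (by linarith))]
    tauto

theorem hitSet_of_isSwitch (h : ReversingIET d b T) {N : ℕ} {R : ℝ} (hR : 0 < R) {e : ℝ}
    (he : IsSwitch (b d) (freeUnion d b T N R) e) : e ∈ hitSet d b T N := by
  obtain ⟨he0, heL, hsw⟩ := he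
  by_contra hnot
  have hcl : IsClosed (hitSet d b T N) := (h.hitSet_finite N).isClosed
  obtain ⟨ε, hε, hball⟩ := Metric.isOpen_iff.1 hcl.isOpen_compl e hnot
  set δ := min (min ε R) (min e (b d - e)) with hδ
  have hδ0 : 0 < δ := lt_min (lt_min hε hR) (lt_min he0 (by linarith))
  have hδ1 : δ ≤ ε := (min_le_left _ _).trans (min_le_left _ _)
  have hδ2 : δ ≤ R := (min_le_left _ _).trans (min_le_right _ _)
  have hδ3 : δ ≤ e := (min_le_right _ _).trans (min_le_left _ _)
  have hδ4 : δ ≤ b d - e := (min_le_right _ _).trans (min_le_right _ _)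
  have hnear : FreeIoo d b T (e - δ) (e + δ) N := by
    refine (ReversingIET.freeIoo_iff (by linarith) (by linarith)).2 fun z hz hz' => ?_
    refine hball ?_ hz
    rw [Metric.mem_ball, Real.dist_eq, abs_lt]
    constructor <;> linarith [hz'.1, hz'.2]
  have hunion : ∀ p q p' q', FreeIoo d b T p q N → FreeIoo d b T p' q' N → p' < q →
      FreeIoo d b T p q' N := by
    intro p q p' q' h1 h2 h3 z hz1 hz2
    rcases lt_or_ge z q with h4 | h4
    · exact h1 z hz1 h4
    · exact h2 z (by linarith) hz2
  obtain ⟨z, hz0, hz1, hz2, hz3⟩ := hsw δ hδ0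
  by_cases hO : e ∈ freeUnion d b T N R
  · have hzO : z ∉ freeUnion d b T N R := by tauto
    obtain ⟨p, hp0, hpe, hep, hpL, hF⟩ := hO
    rcases le_or_gt p z with h1 | h1
    · exact hzO ⟨p, hp0, h1, by linarith, hpL, hF⟩
    · refine hzO ⟨z, hz0, le_rfl, by linarith, by linarith, ?_⟩
      exact (hunion _ _ _ _ hnear hF (by linarith)).mono hz1.le (by linarith) le_rfl
  · have hzO : z ∈ freeUnion d b T N R := by tauto
    obtain ⟨p, hp0, hpz, hzp, hpL, hF⟩ := hzO
    have hpe : p + R ≤ e := by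
      by_contra hc
      exact hO ⟨p, hp0, by linarith, by linarith, hpL, hF⟩
    refine hO ⟨e + δ - R, by linarith, by linarith, by linarith, by linarith, ?_⟩
    exact (hunion _ _ _ _ hF hnear (by linarith)).mono (by linarith) (by linarith) le_rfl

theorem freeCover_of_noIso (h : GenericIET d b T) (hm : Measurable T) {t R : ℝ} (ht : 0 < t)
    (htR : 2 * t ≤ R) (hR : ∀ i < d, R ≤ b (i + 1) - b i) {n : ℕ}
    (hst : FreeStable d b T n t R) (hiso : NoIso d b T (n + 1) t R)
    (hne : (freeUnion d b T (n + 1) R).Nonempty) : FreeCover d b T (n + 1) R := by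
  by_contra hcon
  set O := freeUnion d b T (n + 1) R with hO
  have hR0 : 0 < R := by linarith
  have hinv : ∀ y ∈ O, T y ∈ O := fun y hy => h.mapsTo_freeUnion ht htR hR hst hiso hy
  have hiff : ∀ y, 0 ≤ y → y < b d → (T y ∈ O ↔ y ∈ O) := fun y h0 h1 =>
    ⟨fun h2 => mem_freeUnion_of_map h.toReversingIET hm hinv h0 h1 h2, hinv y⟩
  have hstart : ∃ e, IsSwitch (b d) O e := by
    unfold FreeCover at hcon
    push Not at hcon
    obtain ⟨u, hu0, huL, hu⟩ := hcon
    have huO : u ∉ O := by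
      rintro ⟨p, h1, h2, h3, h4, h5⟩
      exact hu p h1 h2 h3 h4 h5
    obtain ⟨v, hv⟩ := hne
    have hvO := hv
    obtain ⟨p, h1, h2, h3, h4, h5⟩ := hv
    rcases lt_trichotomy u v with huv | rfl | huv
    · exact exists_isSwitch (fun y hy => freeUnion_right_open hy) hu0 huv (by linarith) (by tauto)
    · exact absurd hvO huO
    · exact exists_isSwitch (fun y hy => freeUnion_right_open hy) (by linarith) huv huL (by tauto)
  have hback : ∀ e, IsSwitch (b d) O e → ∃ e', IsSwitch (b d) O e' ∧ T e' = e := by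
    intro e he
    have hhit := hitSet_of_isSwitch h.toReversingIET hR0 he
    obtain ⟨he0, heL, hsw⟩ := he
    obtain ⟨e', h0, h1, rfl⟩ := h.surj he0.le heL
    obtain ⟨i, hi, h2, h3⟩ := h.exists_idx h0 h1
    have hne' : b i ≠ e' := by
      rintro rfl
      obtain ⟨-, -, m, hm, j, hj1, hj, hmj⟩ := hhit
      rw [← Function.iterate_succ_apply] at hmj
      exact h.no_conn i hi j hj1 hj (m + 1) (by omega) hmj
    have hlt : b i < e' := lt_of_le_of_ne h2 hne'
    have hbi := h.nonneg hi.le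
    refine ⟨e', ⟨by linarith, h1, fun ε hε => ?_⟩, rfl⟩
    obtain ⟨z, hz0, hz1, hz2, hz3⟩ := hsw (min ε (e' - b i)) (lt_min hε (by linarith))
    have m1 := min_le_left ε (e' - b i)
    have m2 := min_le_right ε (e' - b i)
    have e1 := h.map_eq i hi e' h2 h3
    have e2 := h.map_eq i hi (e' - (T e' - z)) (by linarith) (by linarith)
    have e3 : T (e' - (T e' - z)) = z := by rw [e2]; linarith
    refine ⟨e' - (T e' - z), by linarith, by linarith, by linarith, ?_⟩
    rw [← hiff _ (by linarith) (by linarith), e3, hz3, hiff e' h0 h1]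
  obtain ⟨e, he⟩ := hstart
  have horb : ∀ m : ℕ, ∃ y, IsSwitch (b d) O y ∧ T^[m] y = e := by
    intro m
    induction m with
    | zero => exact ⟨e, he, rfl⟩
    | succ m ih =>
      obtain ⟨y, hy, hye⟩ := ih
      obtain ⟨y', hy', rfl⟩ := hback y hy
      exact ⟨y', hy', by rw [Function.iterate_succ_apply, hye]⟩
  choose y hy hye using horb
  have hfin := h.hitSet_finite (n + 1)
  obtain ⟨m, -, m', -, hne', heq⟩ := Set.infinite_univ.exists_ne_map_eq_of_mapsTo
    (f := y) (fun m _ => hitSet_of_isSwitch h.toReversingIET hR0 (hy m)) hfin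
  wlog hlt : m < m' generalizing m m'
  · exact this m' m hne'.symm heq.symm (by omega)
  have hmem := hy m
  have e1 := hye m'
  rw [← heq] at e1
  have e2 : T^[m] (T^[m' - m] (y m)) = T^[m] (y m) := by
    rw [← Function.iterate_add_apply, Nat.add_sub_cancel' hlt.le, e1, hye m]
  have hmem2 := h.iterate_mem hmem.1.le hmem.2.1 (m' - m)
  exact h.no_per (y m) hmem.1.le hmem.2.1 (m' - m) (by omega)
    (h.iterate_inj hmem2.1 hmem2.2 hmem.1.le hmem.2.1 m e2)

end GenericIET

theorem FreeCover.mono {d : ℕ} {b : ℕ → ℝ} {T : ℝ → ℝ} {N : ℕ} {R R' : ℝ}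
    (h : FreeCover d b T N R) (hR' : 0 < R') (hle : R' ≤ R) : FreeCover d b T N R' := by
  intro y hy0 hyL
  obtain ⟨p, hp0, hpy, hyp, hpL, hF⟩ := h y hy0 hyL
  rcases le_total y (p + R - R') with hc | hc
  · exact ⟨y, hy0, le_rfl, by linarith, by linarith, hF.mono hpy (by linarith) le_rfl⟩
  · exact ⟨p + R - R', by linarith, hc, by linarith, by linarith,
      hF.mono (by linarith) (by linarith) le_rfl⟩

namespace GenericIET
variable {d : ℕ} {b : ℕ → ℝ} {T : ℝ → ℝ}

theorem freeUnion_nonempty (h : ReversingIET d b T) {N : ℕ} {R : ℝ} (hR : 0 < R)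
    (hgap : R * (N * d + 1) ≤ b d) : (freeUnion d b T N R).Nonempty := by
  by_contra hcon
  rw [not_nonempty_iff_eq_empty, eq_empty_iff_forall_notMem] at hcon
  have hend : ∀ i : ℕ, i < N * d + 1 → i * R + R ≤ b d := by
    intro i hi
    have : (i : ℝ) + 1 ≤ N * d + 1 := by exact_mod_cast hi
    nlinarith
  have hex : ∀ i : ℕ, i < N * d + 1 → ∃ z, i * R < z ∧ z < i * R + R ∧
      ∃ a ∈ Finset.range N ×ˢ Finset.range d, T^[a.1] z = b a.2 := by
    intro i hi
    have hi0 : 0 ≤ i * R := by positivity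
    have h1 : ¬ FreeIoo d b T (i * R) (i * R + R) N := fun hF =>
      hcon (i * R) ⟨i * R, hi0, le_rfl, by linarith, hend i hi, hF⟩
    unfold FreeIoo at h1
    push Not at h1
    obtain ⟨z, hz1, hz2, m, hm, j, hj1, hj, hmj⟩ := h1
    exact ⟨z, hz1, hz2, (m, j), by simp [hm, hj], hmj⟩
  choose! z hz1 hz2 a ha haz using hex
  obtain ⟨i, hi, i', hi', hne, heq⟩ := Finset.exists_ne_map_eq_of_card_lt_of_maps_to
    (s := Finset.range (N * d + 1)) (t := Finset.range N ×ˢ Finset.range d) (f := a)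
    (by simp) (fun i hi => ha i (by simpa using hi))
  rw [Finset.mem_range] at hi hi'
  have hI : ∀ i, i < N * d + 1 → 0 ≤ z i ∧ z i < b d := fun i hi => by
    have : 0 ≤ i * R := by positivity
    constructor <;> linarith [hz1 i hi, hz2 i hi, hend i hi]
  have hzz : z i = z i' := h.iterate_inj (hI i hi).1 (hI i hi).2 (hI i' hi').1 (hI i' hi').2
    (a i).1 (by rw [haz i hi]; nth_rw 2 [heq]; rw [haz i' hi', heq])
  wlog hlt : i < i' generalizing i i'
  · exact this i' hi' i hi hne.symm heq.symm hzz.symm (by omega)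
  have h1 : (i : ℝ) + 1 ≤ i' := by exact_mod_cast hlt
  have h2 := hz2 i hi
  have h3 := hz1 i' hi'
  nlinarith

theorem exists_freeStable (h : ReversingIET d b T) (n : ℕ) {r : ℕ → ℝ} (hr : Antitone r) :
    ∃ s < 2 * d, FreeStable d b T n (r (s + 1)) (r s) := by
  by_contra hcon
  push Not at hcon
  have hex : ∀ s < 2 * d, ∃ a ∈ Finset.range (d - 1) ×ˢ (Finset.univ : Finset Bool),
      ∃ e, 0 ≤ e ∧ e < b d ∧ T^[n] e = b (a.1 + 1) ∧
        (a.2 = true → FreeRight d b T (n + 1) e (r (s + 1)) ∧ ¬ FreeRight d b T (n + 1) e (r s)) ∧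
        (a.2 = false → FreeLeft d b T (n + 1) e (r (s + 1)) ∧
          ¬ FreeLeft d b T (n + 1) e (r s)) := by
    intro s hs
    have h1 := hcon s hs
    unfold FreeStable at h1
    push Not at h1
    obtain ⟨j, hj1, hj, e, h0, h1, he, hstab⟩ := h1
    obtain ⟨j, rfl⟩ := Nat.exists_eq_add_of_le' hj1
    by_cases hc : FreeRight d b T (n + 1) e (r (s + 1)) ∧ ¬ FreeRight d b T (n + 1) e (r s)
    · exact ⟨(j, true), by simp; omega, e, h0, h1, he, fun _ => hc, by simp⟩
    · have := hstab (by tauto)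
      exact ⟨(j, false), by simp; omega, e, h0, h1, he, by simp, fun _ => this⟩
  choose! a ha e h0 h1 he hra hla using hex
  obtain ⟨s, hs, s', hs', hne, heq⟩ := Finset.exists_ne_map_eq_of_card_lt_of_maps_to
    (s := Finset.range (2 * d)) (t := Finset.range (d - 1) ×ˢ (Finset.univ : Finset Bool)) (f := a)
    (by have := h.pos; simp; omega) (fun i hi => ha i (by simpa using hi))
  rw [Finset.mem_range] at hs hs'
  wlog hlt : s < s' generalizing s s'
  · exact this s' hs' s hs hne.symm heq.symm (by omega)
  have hee : e s = e s' := h.iterate_inj (h0 s hs) (h1 s hs) (h0 s' hs') (h1 s' hs') n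
    (by rw [he s hs, he s' hs', heq])
  have hrs : r s' ≤ r (s + 1) := hr hlt
  cases hb : (a s).2 with
  | true =>
    have h2 := (hra s hs hb).1
    have h3 := (hra s' hs' (heq ▸ hb)).2
    rw [hee] at h2
    exact h3 ⟨by linarith [h2.1], h2.2.mono le_rfl (by linarith) le_rfl⟩
  | false =>
    have h2 := (hla s hs hb).1
    have h3 := (hla s' hs' (heq ▸ hb)).2
    rw [hee] at h2
    exact h3 ⟨by linarith [h2.1], h2.2.mono (by linarith) le_rfl le_rfl⟩

theorem freeCover_of_levels (h : GenericIET d b T) (hm : Measurable T) {K ρ : ℝ} (hK : 2 ≤ K)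
    (hρ : 0 < ρ) (hsep : ∀ i < d, ρ ≤ b (i + 1) - b i) {n : ℕ}
    (hgap : ρ * (((n + 1 : ℕ) : ℝ) * d + 1) ≤ b d)
    (hiso : ∀ s < 2 * d, NoIso d b T (n + 1) (ρ / K ^ (s + 1)) (ρ / K ^ s)) :
    FreeCover d b T (n + 1) (ρ / K ^ (2 * d)) := by
  have hanti : Antitone fun s : ℕ => ρ / K ^ s := by
    intro s s' hss
    have : K ^ s ≤ K ^ s' := pow_le_pow_right₀ (by linarith) hss
    dsimp only
    gcongr
  obtain ⟨s, hs, hst⟩ := exists_freeStable h.toReversingIET n hanti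
  have hK0 : 0 < K := by linarith
  have hle : ρ / K ^ s ≤ ρ := by simpa using hanti (Nat.zero_le s)
  have hpos : ∀ s : ℕ, 0 < ρ / K ^ s := fun s => by positivity
  refine (h.freeCover_of_noIso hm (hpos (s + 1)) ?_ (fun i hi => hle.trans (hsep i hi)) hst
    (hiso s hs) (freeUnion_nonempty h.toReversingIET (hpos s) ?_)).mono (hpos _) (hanti hs.le)
  · have : ρ / K ^ s = K * (ρ / K ^ (s + 1)) := by rw [pow_succ]; field_simp
    rw [this]
    have := hpos (s + 1)
    nlinarith
  · refine le_trans ?_ hgap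
    gcongr

end GenericIET

namespace GenericIET
variable {d : ℕ} {b : ℕ → ℝ} {T : ℝ → ℝ}

/-- Two near-hits of `b j` at different times exclude an isolated hit from the left. -/
theorem not_isoRight_of_hit (h : GenericIET d b T) {t R : ℝ}
    (hR : ∀ i < d, R ≤ b (i + 1) - b i) {l j k k' : ℕ} (hl : l < d) (hj1 : 1 ≤ j) (hj : j < d)
    (hk' : 1 ≤ k') (hkk : k' < k) (h1 : b j - R < T^[k'] (b l)) (h2 : T^[k'] (b l) + t < b j + R) :
    ¬ IsoRight d b T t R l j k := by
  rintro ⟨i1, i2, i3⟩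
  have hmem := h.iterate_mem (h.nonneg hl.le) (h.lt_of_lt hl le_rfl)
  rcases lt_trichotomy (T^[k'] (b l)) (b j) with hlt | heq | hgt
  · exact i3 k' hkk (b j) ⟨j, hj1, hj, rfl⟩ ⟨hlt, by linarith⟩
  · exact h.no_conn l hl j hj1 hj k' hk' heq
  · set w := T^[k'] (b l) - T^[k] (b l) with hw
    have hw0 : 0 < w := by linarith
    have hwR : w < R := by linarith
    have hbl : b l + w < b d := by
      linarith [hR l hl, h.le_of_le (show l + 1 ≤ d by omega) le_rfl]
    have htr : ∀ m ≤ k, T^[m] (b l + w) = T^[m] (b l) + w := by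
      intro m hm
      induction m with
      | zero => rfl
      | succ m ih =>
        have ih := ih (by omega)
        rw [Function.iterate_succ_apply', Function.iterate_succ_apply', ih]
        have hm1 := h.iterate_mem (add_nonneg (h.nonneg hl.le) hw0.le) hbl m
        rw [ih] at hm1
        refine h.map_add (hmem m).1 hw0.le hm1.2 fun z hz1 hz2 hb => ?_
        exact i3 m (by omega) z hb ⟨hz1, by linarith⟩
    have e1 : T^[k'] (T^[k - k'] (b l + w)) = T^[k'] (b l) := by
      rw [← Function.iterate_add_apply, Nat.add_sub_cancel' hkk.le, htr k le_rfl, hw]; ring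
    have hm1 := h.iterate_mem (add_nonneg (h.nonneg hl.le) hw0.le) hbl (k - k')
    have e2 := h.iterate_inj hm1.1 hm1.2 (h.nonneg hl.le) (h.lt_of_lt hl le_rfl) k' e1
    rw [htr _ (by omega)] at e2
    rcases Nat.eq_zero_or_pos l with rfl | hl0
    · rw [h.zero] at e2 hmem
      linarith [(hmem (k - k')).1]
    · exact i3 (k - k') (by omega) (b l) ⟨l, hl0, hl, rfl⟩ ⟨by linarith, by linarith⟩

theorem preimage_near_zero (h : ReversingIET d b T) {R : ℝ} (hR : ∀ i < d, R ≤ b (i + 1) - b i)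
    {y : ℝ} (h0 : 0 ≤ y) (h1 : y < b d) (hy : T y < R) : y = b (d - 1) + T y := by
  obtain ⟨i, hi, h2, h3⟩ := h.exists_idx h0 h1
  have e := h.map_eq i hi y h2 h3
  have hid : i = d - 1 := by
    by_contra hc
    have h4 := h.le_of_le (show i + 1 ≤ d - 1 by omega) (by omega)
    have h5 := hR (d - 1) (by omega)
    rw [show d - 1 + 1 = d by omega] at h5
    linarith
  subst hid
  rw [show d - 1 + 1 = d by omega] at e
  linarith

theorem near_zero (h : GenericIET d b T) (hd : 2 ≤ d) {R : ℝ}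
    (hR : ∀ i < d, R ≤ b (i + 1) - b i) {l m k : ℕ} (hl : l < d) (hm1 : 1 ≤ m) (hmk : m ≤ k)
    (hstrip : ∀ m, 1 ≤ m → m < k → ∀ z, IsBreak d b z →
      ¬ (T^[m] (b l) - R < z ∧ z < T^[m] (b l)))
    (hlt : T^[m] (b l) < R) : m = 1 ∧ l = d - 1 ∧ T^[m] (b l) = 0 := by
  obtain ⟨m, rfl⟩ := Nat.exists_eq_add_of_le' hm1
  have hmem := h.iterate_mem (h.nonneg hl.le) (h.lt_of_lt hl le_rfl)
  have h2 := (hmem (m + 1)).1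
  rw [Function.iterate_succ_apply'] at hlt h2 ⊢
  have e := preimage_near_zero h.toReversingIET hR (hmem m).1 (hmem m).2 hlt
  rcases Nat.eq_zero_or_pos m with rfl | hm
  · simp only [Function.iterate_zero, id] at e hlt h2 ⊢
    have hld : l = d - 1 := by
      by_contra hc
      have := h.lt_of_lt (show l < d - 1 by omega) (by omega)
      linarith
    refine ⟨trivial, hld, ?_⟩
    rw [hld] at e ⊢
    linarith
  · exfalso
    rcases h2.eq_or_lt with h3 | h3
    · rw [← h3, add_zero] at e
      exact h.no_conn l hl (d - 1) (by omega) (by omega) m hm e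
    · exact hstrip m hm (by omega) (b (d - 1)) ⟨d - 1, by omega, by omega, rfl⟩
        ⟨by linarith, by linarith⟩

/-- Two near-hits of `b j` at different times exclude an isolated hit from the right. -/
theorem not_isoLeft_of_hit (h : GenericIET d b T) (hd : 2 ≤ d) {t R : ℝ}
    (hR : ∀ i < d, R ≤ b (i + 1) - b i) {l j k k' : ℕ} (hl : l < d) (hj1 : 1 ≤ j) (hj : j < d)
    (hk' : 1 ≤ k') (hkk : k' < k) (h1 : b j + t < T^[k'] (b l) + R) (h2 : T^[k'] (b l) < b j + R) :
    ¬ IsoLeft d b T t R l j k := by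
  rintro ⟨i1, i2, i3⟩
  have hmem := h.iterate_mem (h.nonneg hl.le) (h.lt_of_lt hl le_rfl)
  rcases lt_trichotomy (T^[k'] (b l)) (b j) with hlt | heq | hgt
  · set w := T^[k] (b l) - T^[k'] (b l) with hw
    have hw0 : 0 < w := by linarith
    have hwR : w < R := by linarith
    have hT0 : R ≤ T (b 0) := by
      rw [h.map_b (by omega)]
      have h3 := hR (d - 1) (by omega)
      rw [show d - 1 + 1 = d by omega] at h3
      linarith [h.le_of_le (show 0 + 1 ≤ d - 1 by omega) (by omega)]
    have hpull : ∀ r ≤ k', T^[k' - r] (b l) = T^[k - r] (b l) - w := by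
      intro r hr
      induction r with
      | zero => rw [Nat.sub_zero, Nat.sub_zero, hw]; ring
      | succ r ih =>
        have ih := ih (by omega)
        rw [show k' - r = k' - (r + 1) + 1 by omega, show k - r = k - (r + 1) + 1 by omega,
          Function.iterate_succ_apply', Function.iterate_succ_apply'] at ih
        set m := k - (r + 1) with hm
        have hm1 : 1 ≤ m := by omega
        rcases le_or_gt w (T^[m] (b l)) with hc | hc
        · have e1 := h.map_add (y := T^[m] (b l) - w) (w := w) (by linarith) hw0.le
            (by linarith [(hmem m).2]) ?_
          · rw [sub_add_cancel] at e1
            refine h.inj (hmem _).1 (hmem _).2 (by linarith) (by linarith [(hmem m).2]) ?_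
            linarith
          · intro z hz1 hz2 hz
            rw [sub_add_cancel] at hz2
            rcases hz2.eq_or_lt with hz3 | hz3
            · obtain ⟨i, hi1, hi, rfl⟩ := hz
              exact h.no_conn l hl i hi1 hi m hm1 hz3.symm
            · exact i3 m hm1 (by omega) z hz ⟨by linarith, hz3⟩
        · exfalso
          obtain ⟨n1, n2, n3⟩ := near_zero h hd hR hl hm1 (by omega) i3 (by linarith)
          have hkr : k' - (r + 1) = 0 := by omega
          rw [n3, hkr, ← h.zero] at ih
          simp only [Function.iterate_zero, id] at ih
          have : T (b l) = 0 := by rw [n1] at n3; exact n3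
          linarith
    have e := hpull k' le_rfl
    rw [Nat.sub_self] at e
    simp only [Function.iterate_zero, id] at e
    rcases Nat.eq_zero_or_pos l with rfl | hl0
    · rw [h.zero] at e
      obtain ⟨-, n2, -⟩ := near_zero h hd hR hl (m := k - k') (by omega) (by omega) i3
        (by rw [h.zero]; linarith)
      omega
    · exact i3 (k - k') (by omega) (by omega) (b l) ⟨l, hl0, hl, rfl⟩ ⟨by linarith, by linarith⟩
  · exact h.no_conn l hl j hj1 hj k' hk' heq
  · exact i3 k' hk' hkk (b j) ⟨j, hj1, hj, rfl⟩ ⟨by linarith, hgt⟩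

end GenericIET

/-- A set whose points are followed by long gaps has small measure. -/
theorem volume_le_of_gaps {X : Set ℝ} {α β ε p q : ℝ} {f : ℝ → ℝ} (hX : X ⊆ Icc α β)
    (hαβ : α ≤ β) (hε : 0 < ε) (hp : 0 < p) (hfp : ∀ s ∈ X, p ≤ f s) (hfq : ∀ s ∈ X, f s ≤ q)
    (hq : 0 ≤ q)
    (hgap : ∀ s ∈ X, ∀ s' ∈ X, s ≤ s' → s' ≤ s + f s → s' ≤ s + ε * f s) :
    volume X ≤ ENNReal.ofReal (2 * ε * (β - α + q)) := by
  have key : ∀ n : ℕ, ∀ τ, β - τ < n * p → τ ≤ β + q →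
      volume (X ∩ Ici τ) ≤ ENNReal.ofReal (2 * ε * (β - τ + q)) := by
    intro n
    induction n with
    | zero =>
      intro τ h1 h2
      have : X ∩ Ici τ = ∅ := by
        rw [eq_empty_iff_forall_notMem]
        rintro s ⟨hs, hs'⟩
        have := (hX hs).2
        simp only [mem_Ici] at hs'
        simp at h1
        linarith
      simp [this]
    | succ n ih =>
      intro τ h1 h2
      rcases (X ∩ Ici τ).eq_empty_or_nonempty with hem | hne
      · simp [hem]
      have hbdd : BddBelow (X ∩ Ici τ) := ⟨τ, fun s hs => hs.2⟩
      set u := sInf (X ∩ Ici τ) with hu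
      have hτu : τ ≤ u := le_csInf hne fun s hs => hs.2
      obtain ⟨s, hs, hsu⟩ := exists_lt_of_csInf_lt hne (show u < u + ε * p by
        have := mul_pos hε hp
        linarith)
      have hus : u ≤ s := csInf_le hbdd hs
      have hfs := hfp s hs.1
      have hfs' := hfq s hs.1
      have hsβ := (hX hs.1).2
      have hsub : X ∩ Ici τ ⊆ Icc u (s + ε * f s) ∪ X ∩ Ici (s + f s) := by
        intro z hz
        have huz : u ≤ z := csInf_le hbdd hz
        rcases le_or_gt (s + f s) z with h3 | h3
        · exact Or.inr ⟨hz.1, h3⟩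
        · refine Or.inl ⟨huz, ?_⟩
          rcases le_total s z with h4 | h4
          · exact hgap s hs.1 z hz.1 h4 h3.le
          · have := mul_pos hε (hp.trans_le hfs)
            linarith
      refine (measure_mono hsub).trans ((measure_union_le _ _).trans ?_)
      have h5 := ih (s + f s) (by push_cast at h1; linarith) (by linarith)
      have h6 : volume (Icc u (s + ε * f s)) ≤ ENNReal.ofReal (2 * ε * f s) := by
        rw [Real.volume_Icc]
        refine ENNReal.ofReal_le_ofReal ?_
        have := mul_le_mul_of_nonneg_left hfs hε.le
        linarith
      refine (add_le_add h6 h5).trans ?_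
      have h7 : 0 ≤ 2 * ε * f s := by
        have := hp.trans_le hfs
        positivity
      rw [← ENNReal.ofReal_add h7
        (mul_nonneg (by linarith) (by linarith))]
      refine ENNReal.ofReal_le_ofReal ?_
      have : 2 * ε * τ ≤ 2 * ε * s := by
        refine mul_le_mul_of_nonneg_left (by linarith) (by linarith)
      nlinarith
  obtain ⟨n, hn⟩ := exists_nat_gt ((β - α) / p)
  have h1 := key n α (by rw [div_lt_iff₀ hp] at hn; exact hn) (by linarith)
  rwa [inter_eq_self_of_subset_left (show X ⊆ Ici α from fun s hs => (hX hs).1)] at h1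

/-- The piecewise linear map of slope `ρ ^ (i + 1)` on `[b i, b (i + 1)]`. -/
noncomputable def twist (d : ℕ) (b : ℕ → ℝ) (ρ y : ℝ) : ℝ :=
  y + ∑ k ∈ Finset.range d, (ρ ^ (k + 1) - ρ ^ k) * max (y - b k) 0

/-- A lower bound for the speed at which the orbit of `y` is moved by the twist. -/
noncomputable def drift (d : ℕ) (b : ℕ → ℝ) (T : ℝ → ℝ) (y : ℝ) : ℝ :=
  if b 1 ≤ y then min (T y) (b 1) else b d - max (T y) (b 1)

theorem twist_coeff_nonneg {ρ : ℝ} (hρ : 1 ≤ ρ) (k : ℕ) : 0 ≤ ρ ^ (k + 1) - ρ ^ k :=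
  sub_nonneg.2 (pow_le_pow_right₀ hρ (Nat.le_succ k))

theorem twist_mono {d : ℕ} {b : ℕ → ℝ} {ρ : ℝ} (hρ : 1 ≤ ρ) : Monotone (twist d b ρ) := by
  intro y z hyz
  unfold twist
  refine add_le_add hyz (Finset.sum_le_sum fun k _ => ?_)
  exact mul_le_mul_of_nonneg_left (max_le_max_right _ (by linarith)) (twist_coeff_nonneg hρ k)

theorem twist_sub_le {d : ℕ} {b : ℕ → ℝ} {ρ : ℝ} (hρ : 1 ≤ ρ) {y z : ℝ} (hyz : y ≤ z) :
    twist d b ρ z - twist d b ρ y ≤ ρ ^ d * (z - y) := by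
  have h1 : ∑ k ∈ Finset.range d, (ρ ^ (k + 1) - ρ ^ k) * max (z - b k) 0 ≤
      ∑ k ∈ Finset.range d, ((ρ ^ (k + 1) - ρ ^ k) * max (y - b k) 0 +
        (ρ ^ (k + 1) - ρ ^ k) * (z - y)) := by
    refine Finset.sum_le_sum fun k _ => ?_
    rw [← mul_add]
    refine mul_le_mul_of_nonneg_left ?_ (twist_coeff_nonneg hρ k)
    refine max_le ?_ ?_
    · linarith [le_max_left (y - b k) 0]
    · linarith [le_max_right (y - b k) 0]
  rw [Finset.sum_add_distrib, ← Finset.sum_mul, Finset.sum_range_sub] at h1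
  unfold twist
  linarith

theorem twist_b {d : ℕ} {b b' : ℕ → ℝ} {T : ℝ → ℝ} {ρ : ℝ} (h : ReversingIET d b T)
    (hb0 : b' 0 = 0) (hb : ∀ i < d, b' (i + 1) - b' i = ρ ^ (i + 1) * (b (i + 1) - b i))
    {i : ℕ} (hi : i ≤ d) : twist d b ρ (b i) = b' i := by
  induction i with
  | zero =>
    unfold twist
    rw [Finset.sum_eq_zero, h.zero, hb0, add_zero]
    intro k hk
    have := h.nonneg (Finset.mem_range.1 hk).le
    rw [h.zero, max_eq_right (by linarith), mul_zero]
  | succ i ih =>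
    have ih := ih (by omega)
    have h1 : twist d b ρ (b (i + 1)) - twist d b ρ (b i) = ρ ^ (i + 1) * (b (i + 1) - b i) := by
      unfold twist
      have h2 : ∀ k ∈ Finset.range d, (ρ ^ (k + 1) - ρ ^ k) * max (b (i + 1) - b k) 0 -
          (ρ ^ (k + 1) - ρ ^ k) * max (b i - b k) 0 =
          if k < i + 1 then (ρ ^ (k + 1) - ρ ^ k) * (b (i + 1) - b i) else 0 := by
        intro k hk
        split_ifs with hki
        · have := h.le_of_le (show k ≤ i by omega) (by omega)
          have := h.lt_succ i (by omega)
          rw [max_eq_left (by linarith), max_eq_left (by linarith)]; ring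
        · have := h.le_of_le (show i + 1 ≤ k by omega) (Finset.mem_range.1 hk).le
          have := h.lt_succ i (by omega)
          rw [max_eq_right (by linarith), max_eq_right (by linarith)]; ring
      have h3 : Finset.filter (fun k => k < i + 1) (Finset.range d) = Finset.range (i + 1) := by
        ext k; simp only [Finset.mem_filter, Finset.mem_range]; omega
      have h4 := Finset.sum_congr rfl h2
      rw [Finset.sum_sub_distrib, ← Finset.sum_filter, h3, ← Finset.sum_mul,
        Finset.sum_range_sub] at h4
      linear_combination h4
    linarith [hb i (by omega)]

theorem twist_step {d : ℕ} {b b' : ℕ → ℝ} {T : ℝ → ℝ} {ρ : ℝ} (h : ReversingIET d b T)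
    (hd : 2 ≤ d) (hρ : 1 ≤ ρ)
    (hb0 : b' 0 = 0) (hb : ∀ i < d, b' (i + 1) - b' i = ρ ^ (i + 1) * (b (i + 1) - b i))
    {i : ℕ} (hi : i < d) {y : ℝ} (h1 : b i ≤ y) (h2 : y < b (i + 1)) :
    (ρ - 1) * drift d b T y ≤ twist d b ρ y - b' i + (b' d - b' (i + 1)) - twist d b ρ (T y) := by
  have hy0 : 0 ≤ y := (h.nonneg hi.le).trans h1
  have hyL : y < b d := h2.trans_le (h.le_of_le (by omega) le_rfl)
  have hT := h.mapsTo hy0 hyL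
  have hTy := h.map_eq i hi y h1 h2
  rw [← twist_b h hb0 hb hi.le, ← twist_b h hb0 hb (le_refl d),
    ← twist_b h hb0 hb (show i + 1 ≤ d by omega)]
  set g : ℕ → ℝ := fun k => max (y - b k) 0 - max (b i - b k) 0 + max (b d - b k) 0 -
    max (b (i + 1) - b k) 0 - max (T y - b k) 0 with hg
  have e1 : twist d b ρ y - twist d b ρ (b i) + (twist d b ρ (b d) - twist d b ρ (b (i + 1))) -
      twist d b ρ (T y) = ∑ k ∈ Finset.range d, (ρ ^ (k + 1) - ρ ^ k) * g k := by
    simp only [twist, hg, mul_sub, mul_add, Finset.sum_add_distrib, Finset.sum_sub_distrib]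
    rw [hTy]; ring
  have hglow : ∀ k ≤ i, g k = min (T y) (b k) := by
    intro k hk
    have h3 := h.le_of_le hk hi.le
    have h4 := h.lt_succ i hi
    have h5 := h.le_of_le (show i + 1 ≤ d by omega) le_rfl
    simp only [hg]
    rw [max_eq_left (by linarith), max_eq_left (by linarith), max_eq_left (by linarith),
      max_eq_left (by linarith)]
    rcases le_total (T y) (b k) with h6 | h6
    · rw [max_eq_right (by linarith), min_eq_left h6]; linarith
    · rw [max_eq_left (by linarith), min_eq_right h6]; linarith
  have hghigh : ∀ k, i < k → k ≤ d → g k = b d - max (T y) (b k) := by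
    intro k hk hkd
    have h3 := h.le_of_le (show i + 1 ≤ k by omega) hkd
    have h4 := h.le_of_le hkd le_rfl
    simp only [hg]
    rw [max_eq_right (by linarith), max_eq_right (by linarith), max_eq_left (by linarith),
      max_eq_right (show b (i + 1) - b k ≤ 0 by linarith)]
    rcases le_total (T y) (b k) with h6 | h6
    · rw [max_eq_right (by linarith), max_eq_right h6]; linarith
    · rw [max_eq_left (by linarith), max_eq_left h6]; linarith
  have hgnn : ∀ k < d, 0 ≤ g k := by
    intro k hk
    rcases Nat.lt_or_ge i k with h3 | h3
    · rw [hghigh k h3 hk.le]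
      exact sub_nonneg.2 (max_le hT.2.le (h.le_of_le hk.le le_rfl))
    · rw [hglow k h3]
      exact le_min hT.1 (h.nonneg hk.le)
  have e2 : g 1 = drift d b T y := by
    unfold drift
    split_ifs with h3
    · refine hglow 1 ?_
      by_contra hc
      have : i = 0 := by omega
      subst this
      linarith
    · refine hghigh 1 ?_ (by omega)
      by_contra hc
      exact h3 ((h.le_of_le (show 1 ≤ i by omega) hi.le).trans h1)
  rw [e1, ← e2]
  refine le_trans ?_ (Finset.single_le_sum (f := fun k => (ρ ^ (k + 1) - ρ ^ k) * g k)
    (fun k hk => mul_nonneg (twist_coeff_nonneg hρ k) (hgnn k (Finset.mem_range.1 hk)))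
    (Finset.mem_range.2 (show 1 < d by omega)))
  refine mul_le_mul_of_nonneg_right ?_ (hgnn 1 (by omega))
  rw [pow_one, show (1 + 1 : ℕ) = 2 from rfl]
  nlinarith [mul_self_nonneg (ρ - 1)]

theorem drift_nonneg {d : ℕ} {b : ℕ → ℝ} {T : ℝ → ℝ} (h : ReversingIET d b T) {y : ℝ}
    (h0 : 0 ≤ y) (h1 : y < b d) : 0 ≤ drift d b T y := by
  have hT := h.mapsTo h0 h1
  unfold drift
  split_ifs
  · exact le_min hT.1 (h.nonneg h.pos)
  · exact sub_nonneg.2 (max_le hT.2.le (h.le_of_le h.pos le_rfl))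

theorem drift_add_drift {d : ℕ} {b : ℕ → ℝ} {T : ℝ → ℝ} (h : ReversingIET d b T) (hd : 2 ≤ d)
    {c : ℝ} (hc1 : 2 * c ≤ b 1) (hc2 : 2 * c ≤ b d - b (d - 1)) (hc0 : 0 < c) {y : ℝ}
    (h0 : 0 ≤ y) (h1 : y < b d) : c ≤ drift d b T y + drift d b T (T y) := by
  have hT := h.mapsTo h0 h1
  have hn1 := drift_nonneg h h0 h1
  have hn2 := drift_nonneg h hT.1 hT.2
  have hmid := h.le_of_le (show 1 ≤ d - 1 by omega) (by omega)
  have hI0 : ∀ z, 0 ≤ z → z < b 1 → T z = z + (b d - b 1) := by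
    intro z hz hz'
    rw [h.map_eq 0 (by omega) z (by rw [h.zero]; exact hz) hz', h.zero]; ring
  rcases le_or_gt (b 1) y with hy | hy
  · rcases le_or_gt c (T y) with hTy | hTy
    · have : c ≤ drift d b T y := by
        rw [drift, if_pos hy]; exact le_min hTy (by linarith)
      linarith
    · have : c ≤ drift d b T (T y) := by
        rw [drift, if_neg (by linarith), hI0 _ hT.1 (by linarith), le_sub_comm]
        exact max_le (by linarith) (by linarith)
      linarith
  · have hTy := hI0 y h0 hy
    rcases le_or_gt c (b 1 - y) with hc | hc
    · have : c ≤ drift d b T y := by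
        rw [drift, if_neg (by linarith), hTy, le_sub_comm]
        exact max_le (by linarith) (by linarith)
      linarith
    · have e := h.map_eq (d - 1) (by omega) (T y) (by linarith)
        (by rw [show d - 1 + 1 = d by omega]; exact hT.2)
      rw [show d - 1 + 1 = d by omega] at e
      have : c ≤ drift d b T (T y) := by
        rw [drift, if_pos (by linarith), e]
        exact le_min (by linarith) (by linarith)
      linarith

/-- The orbits of `b l` and `b' l` visit intervals with the same indices up to time `k`. -/
def SameItinerary (d : ℕ) (b b' : ℕ → ℝ) (T T' : ℝ → ℝ) (l k : ℕ) : Prop :=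
  ∀ m < k, ∃ i < d, (b i ≤ T^[m] (b l) ∧ T^[m] (b l) < b (i + 1)) ∧
    b' i ≤ T'^[m] (b' l) ∧ T'^[m] (b' l) < b' (i + 1)

theorem SameItinerary.mono {d : ℕ} {b b' : ℕ → ℝ} {T T' : ℝ → ℝ} {l k k' : ℕ}
    (h : SameItinerary d b b' T T' l k) (hk : k' ≤ k) : SameItinerary d b b' T T' l k' :=
  fun m hm => h m (by omega)

theorem twist_orbit {d : ℕ} {b b' : ℕ → ℝ} {T T' : ℝ → ℝ} {ρ : ℝ} (h : ReversingIET d b T)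
    (h' : ReversingIET d b' T') (hd : 2 ≤ d) (hρ : 1 ≤ ρ)
    (hb : ∀ i < d, b' (i + 1) - b' i = ρ ^ (i + 1) * (b (i + 1) - b i)) {l k : ℕ} (hl : l < d)
    (hit : SameItinerary d b b' T T' l k) :
    (ρ - 1) * ∑ m ∈ Finset.range k, drift d b T (T^[m] (b l)) ≤
      T'^[k] (b' l) - twist d b ρ (T^[k] (b l)) := by
  induction k with
  | zero => simp [twist_b h h'.zero hb hl.le]
  | succ k ih =>
    have ih := ih (hit.mono (Nat.le_succ k))
    obtain ⟨i, hi, ⟨h1, h2⟩, h3, h4⟩ := hit k (Nat.lt_succ_self k)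
    have e1 := twist_step h hd hρ h'.zero hb hi h1 h2
    rw [Finset.sum_range_succ, mul_add, Function.iterate_succ_apply', Function.iterate_succ_apply',
      h'.map_eq i hi _ h3 h4]
    linarith

theorem twist_orbit_nonneg {d : ℕ} {b b' : ℕ → ℝ} {T T' : ℝ → ℝ} {ρ : ℝ}
    (h : ReversingIET d b T)
    (h' : ReversingIET d b' T') (hd : 2 ≤ d) (hρ : 1 ≤ ρ)
    (hb : ∀ i < d, b' (i + 1) - b' i = ρ ^ (i + 1) * (b (i + 1) - b i)) {l k : ℕ} (hl : l < d)
    (hit : SameItinerary d b b' T T' l k) :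
    twist d b ρ (T^[k] (b l)) ≤ T'^[k] (b' l) := by
  have h1 := twist_orbit h h' hd hρ hb hl hit
  have h2 : 0 ≤ ∑ m ∈ Finset.range k, drift d b T (T^[m] (b l)) :=
    Finset.sum_nonneg fun m _ => by
      have := h.iterate_mem (h.nonneg hl.le) (h.lt_of_lt hl le_rfl) m
      exact drift_nonneg h this.1 this.2
  have h3 := mul_nonneg (sub_nonneg.2 hρ) h2
  linarith

theorem drift_sum {d : ℕ} {b : ℕ → ℝ} {T : ℝ → ℝ} (h : ReversingIET d b T) (hd : 2 ≤ d)
    {c : ℝ} (hc1 : 2 * c ≤ b 1) (hc2 : 2 * c ≤ b d - b (d - 1)) (hc0 : 0 < c) {l k : ℕ}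
    (hl : l < d) (hk : 1 ≤ k) (hhit : b 1 - c ≤ T^[k] (b l)) :
    c * k / 4 ≤ ∑ m ∈ Finset.range k, drift d b T (T^[m] (b l)) := by
  have hmem := h.iterate_mem (h.nonneg hl.le) (h.lt_of_lt hl le_rfl)
  have hdn : ∀ m, 0 ≤ drift d b T (T^[m] (b l)) := fun m =>
    drift_nonneg h (hmem m).1 (hmem m).2
  have key : ∀ k : ℕ, k * c + drift d b T (T^[k] (b l)) ≤
      2 * ∑ m ∈ Finset.range (k + 1), drift d b T (T^[m] (b l)) := by
    intro k
    induction k with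
    | zero => simp; linarith [hdn 0, show drift d b T (T^[0] (b l)) = drift d b T (b l) from rfl]
    | succ k ih =>
      rw [Finset.sum_range_succ]
      have := drift_add_drift h hd hc1 hc2 hc0 (hmem k).1 (hmem k).2
      rw [← Function.iterate_succ_apply' T] at this
      push_cast
      linarith
  obtain ⟨k, rfl⟩ := Nat.exists_eq_add_of_le' hk
  rcases Nat.eq_zero_or_pos k with rfl | hk0
  · simp only [zero_add, Finset.sum_range_one, Function.iterate_zero, id, Nat.cast_one,
      Function.iterate_one] at hhit ⊢
    have hmid := h.le_of_le (show 1 ≤ d - 1 by omega) (by omega)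
    have : c ≤ drift d b T (b l) := by
      rcases Nat.eq_zero_or_pos l with rfl | hl0
      · rw [drift, h.zero, if_neg (by linarith), ← h.zero, h.map_b hl, zero_add, le_sub_comm]
        exact max_le (by linarith) (by linarith)
      · rw [drift, if_pos (h.le_of_le hl0 hl.le)]
        exact le_min (by linarith) (by linarith)
    linarith
  · have h1 := key k
    have h2 := hdn k
    have h3 : (1 : ℝ) ≤ k := by exact_mod_cast hk0
    push_cast
    nlinarith

/-- Two interval exchanges whose `i`-th lengths differ by the factor `ρ ^ (i + 1)`. -/
structure TwistPair (d : ℕ) (b b' : ℕ → ℝ) (T T' : ℝ → ℝ) (ρ : ℝ) : Prop where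
  fst : GenericIET d b T
  snd : GenericIET d b' T'
  two_le : 2 ≤ d
  one_le : 1 ≤ ρ
  scale : ∀ i < d, b' (i + 1) - b' i = ρ ^ (i + 1) * (b (i + 1) - b i)

namespace TwistPair
variable {d : ℕ} {b b' : ℕ → ℝ} {T T' : ℝ → ℝ} {ρ : ℝ}

theorem length_le (P : TwistPair d b b' T T' ρ) {i : ℕ} (hi : i < d) :
    b (i + 1) - b i ≤ b' (i + 1) - b' i := by
  rw [P.scale i hi]
  have h1 := one_le_pow₀ P.one_le (n := i + 1)
  have h2 := P.fst.lt_succ i hi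
  nlinarith

theorem diff_mono (P : TwistPair d b b' T T' ρ) {i j : ℕ} (hij : i ≤ j) (hj : j ≤ d) :
    b' i - b i ≤ b' j - b j := by
  induction j, hij using Nat.le_induction with
  | base => exact le_rfl
  | succ j hij ih => linarith [ih (by omega), P.length_le (show j < d by omega)]

theorem diff_nonneg (P : TwistPair d b b' T T' ρ) {i : ℕ} (hi : i ≤ d) : b i ≤ b' i := by
  have := P.diff_mono (Nat.zero_le i) hi
  rw [P.fst.zero, P.snd.zero] at this
  linarith

theorem orbit_close (P : TwistPair d b b' T T' ρ) {l k : ℕ} (hl : l < d)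
    (hit : SameItinerary d b b' T T' l k) :
    |T'^[k] (b' l) - T^[k] (b l)| ≤ (k + 1) * (b' d - b d) := by
  induction k with
  | zero =>
    have h1 := P.diff_mono hl.le le_rfl
    have h2 := P.diff_nonneg hl.le
    simp only [Function.iterate_zero, id, Nat.cast_zero]
    rw [abs_le]; constructor <;> linarith
  | succ k ih =>
    have ih := ih (hit.mono (Nat.le_succ k))
    obtain ⟨i, hi, ⟨h1, h2⟩, h3, h4⟩ := hit k (Nat.lt_succ_self k)
    rw [Function.iterate_succ_apply', Function.iterate_succ_apply',
      P.snd.map_eq i hi _ h3 h4, P.fst.map_eq i hi _ h1 h2]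
    have h5 := P.diff_mono (show i + 1 ≤ d by omega) le_rfl
    have h6 := P.diff_mono (Nat.le_succ i) (show i + 1 ≤ d by omega)
    have h7 := P.diff_nonneg hi.le
    have h8 := P.diff_mono hi.le le_rfl
    rw [abs_le] at ih ⊢
    push_cast
    constructor <;> linarith [ih.1, ih.2]

theorem twist_le_orbit (P : TwistPair d b b' T T' ρ) {l k : ℕ} (hl : l < d)
    (hit : SameItinerary d b b' T T' l k) : twist d b ρ (T^[k] (b l)) ≤ T'^[k] (b' l) :=
  twist_orbit_nonneg P.fst.toReversingIET P.snd.toReversingIET P.two_le P.one_le P.scale hl hit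

theorem twist_break (P : TwistPair d b b' T T' ρ) {i : ℕ} (hi : i ≤ d) :
    twist d b ρ (b i) = b' i :=
  twist_b P.fst.toReversingIET P.snd.zero P.scale hi

theorem mul_le_of_le {m k : ℕ} {D R : ℝ} (hD : 0 ≤ D) (hmk : m ≤ k) (hk : k * D ≤ R) :
    m * D ≤ R :=
  (mul_le_mul_of_nonneg_right (by exact_mod_cast hmk) hD).trans hk

theorem sameItinerary_of_isoRight (P : TwistPair d b b' T T' ρ) {t R : ℝ}
    {l j k : ℕ} (hl : l < d) (hk : k * (b' d - b d) < R) (hI : IsoRight d b T t R l j k) :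
    SameItinerary d b b' T T' l k := by
  have hD := sub_nonneg.2 (P.diff_nonneg le_rfl)
  have hmem := P.fst.iterate_mem (P.fst.nonneg hl.le) (P.fst.lt_of_lt hl le_rfl)
  have hmem' := P.snd.iterate_mem (P.snd.nonneg hl.le) (P.snd.lt_of_lt hl le_rfl)
  have key : ∀ m ≤ k, SameItinerary d b b' T T' l m := by
    intro m
    induction m with
    | zero => intro _ m hm; omega
    | succ m ih =>
      intro hm
      have ih := ih (by omega)
      intro n hn
      rcases Nat.lt_or_ge n m with h1 | h1
      · exact ih n h1
      obtain rfl : n = m := by omega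
      obtain ⟨i, hi, h2, h3⟩ := P.fst.exists_idx (hmem n).1 (hmem n).2
      refine ⟨i, hi, ⟨h2, h3⟩, ?_, ?_⟩
      · rw [← P.twist_break hi.le]
        exact (twist_mono P.one_le h2).trans (P.twist_le_orbit hl ih)
      · rcases Nat.lt_or_ge (i + 1) d with h4 | h4
        · have h5 := hI.2.2 n (by omega) (b (i + 1)) ⟨i + 1, by omega, h4, rfl⟩
          have h6 : T^[n] (b l) + R ≤ b (i + 1) := by
            by_contra hc
            exact h5 ⟨h3, by linarith⟩
          have h7 := (abs_le.1 (P.orbit_close hl ih)).2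
          have h8 := (mul_le_of_le hD hm le_rfl).trans_lt hk
          push_cast at h8
          linarith [P.diff_nonneg h4.le]
        · rw [show i + 1 = d by omega]
          exact (hmem' n).2
  exact key k le_rfl

theorem sameItinerary_of_isoLeft (P : TwistPair d b b' T T' ρ) {t R : ℝ}
    {l j k : ℕ} (hl : l < d) (hk : k * (b' d - b d) < R) (hI : IsoLeft d b' T' t R l j k) :
    SameItinerary d b b' T T' l k := by
  have hD := sub_nonneg.2 (P.diff_nonneg le_rfl)
  have hmem := P.fst.iterate_mem (P.fst.nonneg hl.le) (P.fst.lt_of_lt hl le_rfl)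
  have hmem' := P.snd.iterate_mem (P.snd.nonneg hl.le) (P.snd.lt_of_lt hl le_rfl)
  have key : ∀ m ≤ k, SameItinerary d b b' T T' l m := by
    intro m
    induction m with
    | zero => intro _ m hm; omega
    | succ m ih =>
      intro hm
      have ih := ih (by omega)
      intro n hn
      rcases Nat.lt_or_ge n m with h1 | h1
      · exact ih n h1
      obtain rfl : n = m := by omega
      rcases Nat.eq_zero_or_pos n with rfl | hn0
      · exact ⟨l, hl, ⟨le_rfl, P.fst.lt_succ l hl⟩, le_rfl, P.snd.lt_succ l hl⟩
      obtain ⟨i, hi, h2, h3⟩ := P.snd.exists_idx (hmem' n).1 (hmem' n).2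
      refine ⟨i, hi, ⟨?_, ?_⟩, h2, h3⟩
      · rcases Nat.eq_zero_or_pos i with rfl | hi0
        · rw [P.fst.zero]; exact (hmem n).1
        have h5 := hI.2.2 n hn0 (by omega) (b' i) ⟨i, hi0, hi, rfl⟩
        have h6 : b' i < T'^[n] (b' l) :=
          lt_of_le_of_ne h2 fun he => P.snd.no_conn l hl i hi0 hi n hn0 he.symm
        have h6 : b' i ≤ T'^[n] (b' l) - R := by
          by_contra hc
          exact h5 ⟨by linarith, h6⟩
        have h7 := (abs_le.1 (P.orbit_close hl ih)).2
        have h8 := (mul_le_of_le hD hm le_rfl).trans_lt hk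
        push_cast at h8
        linarith [P.diff_nonneg hi.le]
      · by_contra hc
        have h4 := twist_mono P.one_le (not_lt.1 hc) (d := d) (b := b)
        rw [P.twist_break (show i + 1 ≤ d by omega)] at h4
        linarith [P.twist_le_orbit hl ih]
  exact key k le_rfl

theorem drift_le (P : TwistPair d b b' T T' ρ) {c e : ℝ} (hc1 : 2 * c ≤ b 1)
    (hc2 : 2 * c ≤ b d - b (d - 1)) (hc0 : 0 < c) {l k : ℕ} (hl : l < d) (hk : 1 ≤ k)
    (hhit : b 1 - c ≤ T^[k] (b l)) (hit : SameItinerary d b b' T T' l k)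
    (he : T'^[k] (b' l) - twist d b ρ (T^[k] (b l)) ≤ e) : (ρ - 1) * (c * k) ≤ 4 * e := by
  have h1 := drift_sum P.fst.toReversingIET P.two_le hc1 hc2 hc0 hl hk hhit
  have h2 := twist_orbit P.fst.toReversingIET P.snd.toReversingIET P.two_le P.one_le P.scale hl hit
  have h3 := mul_le_mul_of_nonneg_left h1 (sub_nonneg.2 P.one_le)
  linarith

theorem le_of_isoRight (P : TwistPair d b b' T T' ρ) {c t R : ℝ} (hc1 : 2 * c ≤ b 1)
    (hc2 : 2 * c ≤ b d - b (d - 1)) (hc0 : 0 < c) (hR0 : 0 < R) (htR : t ≤ R / 4)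
    (htc : t ≤ c) (hR : ∀ i < d, R ≤ b (i + 1) - b i) {l j k k' : ℕ} (hl : l < d) (hj1 : 1 ≤ j)
    (hj : j < d) (hk : 1 ≤ k) (hk' : 1 ≤ k') (hkD : (k + 2) * (b' d - b d) ≤ R / 4)
    (hI : IsoRight d b T t R l j k) (hI' : IsoRight d b' T' t R l j k') :
    (ρ - 1) * (c * k) ≤ 4 * ρ ^ d * t := by
  have hD := sub_nonneg.2 (P.diff_nonneg le_rfl)
  have hR' : ∀ i < d, R ≤ b' (i + 1) - b' i := fun i hi => (hR i hi).trans (P.length_le hi)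
  have hit := P.sameItinerary_of_isoRight hl (by linarith) hI
  have h1 := P.diff_nonneg hj.le
  have h2 := P.diff_mono hj.le le_rfl
  have hDR := mul_le_of_le (m := 1) (k := k + 2) (R := R / 4) hD (by omega)
    (by push_cast; linarith)
  rw [Nat.cast_one, one_mul] at hDR
  have hkk : k' = k := by
    rcases lt_trichotomy k' k with h3 | h3 | h3
    · exfalso
      have h4 := abs_le.1 (P.orbit_close hl (hit.mono h3.le))
      have h5 := mul_le_of_le (m := k' + 1) (k := k + 1) (R := R / 4) hD (by omega)
        (by push_cast; linarith)
      push_cast at h5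
      exact P.fst.not_isoRight_of_hit hR hl hj1 hj hk' h3 (by linarith [hI'.2.1])
        (by linarith [hI'.1]) hI
    · exact h3
    · exfalso
      have h4 := abs_le.1 (P.orbit_close hl hit)
      exact P.snd.not_isoRight_of_hit hR' hl hj1 hj hk h3 (by linarith [hI.2.1])
        (by linarith [hI.1]) hI'
  subst hkk
  have h3 := P.fst.le_of_le hj1 hj.le
  rw [mul_assoc]
  refine P.drift_le hc1 hc2 hc0 hl hk (by linarith [hI.2.1]) hit ?_
  have h4 := twist_sub_le P.one_le (d := d) (b := b) hI.1
  rw [P.twist_break hj.le] at h4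
  have h5 : ρ ^ d * (b j - T^[k'] (b l)) ≤ ρ ^ d * t :=
    mul_le_mul_of_nonneg_left (by linarith [hI.2.1]) (pow_nonneg (by linarith [P.one_le]) d)
  linarith [hI'.1]

theorem le_of_isoLeft (P : TwistPair d b b' T T' ρ) {c t R : ℝ} (hc1 : 2 * c ≤ b 1)
    (hc2 : 2 * c ≤ b d - b (d - 1)) (hc0 : 0 < c) (hR0 : 0 < R) (ht0 : 0 ≤ t) (htR : t ≤ R / 4)
    (hR : ∀ i < d, R ≤ b (i + 1) - b i) {l j k k' : ℕ} (hl : l < d) (hj1 : 1 ≤ j)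
    (hj : j < d) (hk : 1 ≤ k) (hk' : 1 ≤ k') (hkD : (k + 2) * (b' d - b d) ≤ R / 4)
    (hI : IsoLeft d b T t R l j k') (hI' : IsoLeft d b' T' t R l j k) :
    (ρ - 1) * (c * k) ≤ 4 * ρ ^ d * t := by
  have hD := sub_nonneg.2 (P.diff_nonneg le_rfl)
  have hR' : ∀ i < d, R ≤ b' (i + 1) - b' i := fun i hi => (hR i hi).trans (P.length_le hi)
  have hit := P.sameItinerary_of_isoLeft hl (by linarith) hI'
  have h1 := P.diff_nonneg hj.le
  have h2 := P.diff_mono hj.le le_rfl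
  have hDR := mul_le_of_le (m := 1) (k := k + 2) (R := R / 4) hD (by omega)
    (by push_cast; linarith)
  rw [Nat.cast_one, one_mul] at hDR
  have hkk : k' = k := by
    rcases lt_trichotomy k' k with h3 | h3 | h3
    · exfalso
      have h4 := abs_le.1 (P.orbit_close hl (hit.mono h3.le))
      have h5 := mul_le_of_le (m := k' + 1) (k := k + 1) (R := R / 4) hD (by omega)
        (by push_cast; linarith)
      push_cast at h5
      exact P.snd.not_isoLeft_of_hit P.two_le hR' hl hj1 hj hk' h3 (by linarith [hI.1])
        (by linarith [hI.2.1]) hI'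
    · exact h3
    · exfalso
      have h4 := abs_le.1 (P.orbit_close hl hit)
      exact P.fst.not_isoLeft_of_hit P.two_le hR hl hj1 hj hk h3 (by linarith [hI'.1])
        (by linarith [hI'.2.1]) hI
  subst hkk
  have h3 := P.fst.le_of_le hj1 hj.le
  rw [mul_assoc]
  refine P.drift_le hc1 hc2 hc0 hl hk (by linarith [hI.1]) hit ?_
  have h4 := twist_mono P.one_le (d := d) (b := b) hI.1
  rw [P.twist_break hj.le] at h4
  have h5 := one_le_pow₀ P.one_le (n := d)
  have h6 : t ≤ ρ ^ d * t := le_mul_of_one_le_left ht0 h5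
  linarith [hI'.2.1]

end TwistPair

theorem volume_le_of_close {I : ℝ → ℕ → Prop} {α β Λ E t R : ℝ} {N : ℕ} (hαβ : α ≤ β)
    (hN : 1 ≤ N) (hΛ : 1 ≤ Λ) (hE : 0 < E) (ht : 0 < t) (hR : 0 < R) (hR1 : R ≤ 1)
    (hI : ∀ s ∈ Icc α β, ∀ s' ∈ Icc α β, s ≤ s' → ∀ k k', 1 ≤ k → 1 ≤ k' → I s k → I s' k' →
      (k + 2) * (Λ * (s' - s)) ≤ R / 4 → (s' - s) * k ≤ E * t) :
    volume {x | x ∈ Icc α β ∧ ∃ k, 1 ≤ k ∧ k ≤ N ∧ I x k} ≤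
      ENNReal.ofReal (24 * Λ * E * (β - α + 1) * (t / R)) := by
  classical
  set X := {x | x ∈ Icc α β ∧ ∃ k, 1 ≤ k ∧ k ≤ N ∧ I x k} with hX
  have hch : ∀ x, ∃ k : ℕ, x ∈ X → 1 ≤ k ∧ k ≤ N ∧ I x k := by
    intro x
    by_cases hx : x ∈ X
    · obtain ⟨k, hk⟩ := hx.2
      exact ⟨k, fun _ => hk⟩
    · exact ⟨0, fun h => absurd h hx⟩
  choose κ hκ using hch
  have hκ1 : ∀ x ∈ X, (1 : ℝ) ≤ κ x := fun x hx => by exact_mod_cast (hκ x hx).1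
  have hΛ0 : 0 < Λ := by linarith
  have hNr : (1 : ℝ) ≤ N := by exact_mod_cast hN
  have h := volume_le_of_gaps (X := X) (α := α) (β := β) (ε := 12 * Λ * E * t / R)
    (p := R / (12 * Λ * N)) (q := 1) (f := fun x => R / (12 * Λ * κ x)) (fun x hx => hx.1) hαβ
    (by positivity) (by positivity) ?_ ?_ zero_le_one ?_
  · refine h.trans_eq ?_
    congr 1
    field_simp
    ring
  · intro s hs
    have h1 := hκ1 s hs
    have h2 : (κ s : ℝ) ≤ N := by exact_mod_cast (hκ s hs).2.1
    refine div_le_div_of_nonneg_left hR.le (by positivity) ?_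
    exact mul_le_mul_of_nonneg_left h2 (by positivity)
  · intro s hs
    have h1 := hκ1 s hs
    refine (div_le_one (by positivity)).2 ?_
    nlinarith
  · intro s hs s' hs' hss hle
    have h1 := hκ1 s hs
    have h3 : (s' - s) * (12 * Λ * κ s) ≤ R := by
      rw [← le_div_iff₀ (by positivity)]; linarith
    have h4 := hI s hs.1 s' hs'.1 hss (κ s) (κ s') (hκ s hs).1 (hκ s' hs').1 (hκ s hs).2.2
      (hκ s' hs').2.2 (by
        have : 0 ≤ Λ * (s' - s) := mul_nonneg hΛ0.le (by linarith)
        nlinarith)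
    have h5 : 12 * Λ * E * t / R * (R / (12 * Λ * κ s)) = E * t / κ s := by
      have : (0 : ℝ) < κ s := by linarith
      field_simp
    rw [h5]
    have : s' - s ≤ E * t / κ s := by rwa [le_div_iff₀ (by linarith)]
    linarith

theorem volume_le_of_close_neg {I : ℝ → ℕ → Prop} {α β Λ E t R : ℝ} {N : ℕ} (hαβ : α ≤ β)
    (hN : 1 ≤ N) (hΛ : 1 ≤ Λ) (hE : 0 < E) (ht : 0 < t) (hR : 0 < R) (hR1 : R ≤ 1)
    (hI : ∀ s ∈ Icc α β, ∀ s' ∈ Icc α β, s ≤ s' → ∀ k k', 1 ≤ k → 1 ≤ k' → I s k' → I s' k →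
      (k + 2) * (Λ * (s' - s)) ≤ R / 4 → (s' - s) * k ≤ E * t) :
    volume {x | x ∈ Icc α β ∧ ∃ k, 1 ≤ k ∧ k ≤ N ∧ I x k} ≤
      ENNReal.ofReal (24 * Λ * E * (β - α + 1) * (t / R)) := by
  have h := volume_le_of_close (I := fun x k => I (-x) k) (α := -β) (β := -α) (t := t)
    (N := N) (neg_le_neg hαβ) hN hΛ hE ht hR hR1 ?_
  · rw [show -α - -β + 1 = β - α + 1 by ring] at h
    refine le_trans (le_of_eq ?_) h
    rw [← Measure.measure_preimage_neg]
    congr 1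
    ext x
    simp only [mem_preimage, mem_ofPred_eq, mem_Icc]
    constructor <;> rintro ⟨h1, h2⟩ <;>
      exact ⟨⟨by linarith [h1.1, h1.2], by linarith [h1.1, h1.2]⟩, h2⟩
  · intro s hs s' hs' hss k k' hk hk' h1 h2 h3
    have := hI (-s') ⟨by linarith [hs'.2], by linarith [hs'.1]⟩ (-s)
      ⟨by linarith [hs.2], by linarith [hs.1]⟩ (by linarith) k k' hk hk' h2 h1
    rw [show -s - -s' = s' - s by ring] at this
    exact this h3

theorem exists_pow_sub_le (β : ℝ) (n : ℕ) : ∃ Λ : ℝ, 0 ≤ Λ ∧ ∀ x y, 0 < x → x ≤ y → y ≤ β →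
    y ^ n - x ^ n ≤ Λ * (y - x) := by
  induction n with
  | zero => exact ⟨0, le_rfl, by simp⟩
  | succ n ih =>
    obtain ⟨Λ, h0, h⟩ := ih
    refine ⟨|β| * Λ + |β| ^ n, by positivity, fun x y hx hxy hy => ?_⟩
    have h1 := h x y hx hxy hy
    have hyβ : y ≤ |β| := hy.trans (le_abs_self β)
    have h2 : x ^ n ≤ |β| ^ n := pow_le_pow_left₀ hx.le (hxy.trans hyβ) n
    have e : y ^ (n + 1) - x ^ (n + 1) = y * (y ^ n - x ^ n) + x ^ n * (y - x) := by ring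
    have h3 : 0 ≤ y ^ n - x ^ n := sub_nonneg.2 (pow_le_pow_left₀ hx.le hxy n)
    rw [e, add_mul]
    refine add_le_add ?_ (mul_le_mul_of_nonneg_right h2 (by linarith))
    rw [mul_assoc]
    exact mul_le_mul hyβ h1 h3 (abs_nonneg β)

theorem exists_powSum_sub_le (β : ℝ) (d : ℕ) : ∃ Λ : ℝ, 1 ≤ Λ ∧ ∀ x y, 0 < x → x ≤ y → y ≤ β →
    powSum y d - powSum x d ≤ Λ * (y - x) := by
  induction d with
  | zero =>
    refine ⟨1, le_rfl, fun x y _ hxy _ => ?_⟩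
    rw [powSum_zero, powSum_zero]; linarith
  | succ d ih =>
    obtain ⟨Λ, h1, h⟩ := ih
    obtain ⟨Λ', h1', h'⟩ := exists_pow_sub_le β (d + 1)
    refine ⟨Λ + Λ', by linarith, fun x y hx hxy hy => ?_⟩
    rw [powSum_succ, powSum_succ]
    linarith [h x y hx hxy hy, h' x y hx hxy hy]

theorem twistPair_pow {d : ℕ} {x y : ℝ} {T T' : ℝ → ℝ} (hd : 2 ≤ d) (hx : 0 < x) (hxy : x ≤ y)
    (h : GenericIET d (powSum x) T) (h' : GenericIET d (powSum y) T') :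
    TwistPair d (powSum x) (powSum y) T T' (y / x) := by
  refine ⟨h, h', hd, (one_le_div hx).2 hxy, fun i _ => ?_⟩
  rw [powSum_succ, powSum_succ, add_sub_cancel_left, add_sub_cancel_left, div_pow,
    div_mul_cancel₀ _ (pow_ne_zero _ hx.ne')]

theorem sub_mul_le_of_ratio {x y α β c t k : ℝ} {d : ℕ} (hα : 0 < α) (hc : 0 < c) (ht : 0 ≤ t)
    (hx : α ≤ x) (hxy : x ≤ y) (hy : y ≤ β)
    (h : (y / x - 1) * (c * k) ≤ 4 * (y / x) ^ d * t) :
    (y - x) * k ≤ 4 * β * (β / α) ^ d / c * t := by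
  have hx0 : 0 < x := hα.trans_le hx
  have hy0 : 0 < y := hx0.trans_le hxy
  have h1 : (y / x) ^ d ≤ (β / α) ^ d :=
    pow_le_pow_left₀ (by positivity) (div_le_div₀ (by linarith) hy hα hx) d
  have h2 := mul_le_mul_of_nonneg_left h hx0.le
  have e : x * ((y / x - 1) * (c * k)) = (y - x) * k * c := by field_simp
  rw [e] at h2
  have h3 : x * (4 * (y / x) ^ d * t) ≤ β * (4 * (β / α) ^ d * t) :=
    mul_le_mul (by linarith) (by gcongr) (by positivity) (by linarith)
  rw [show 4 * β * (β / α) ^ d / c * t = β * (4 * (β / α) ^ d * t) / c by ring, le_div_iff₀ hc]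
  linarith

theorem exists_volume_iso_le {d : ℕ} (hd : 2 ≤ d) (T : ℝ → ℝ → ℝ) {α β : ℝ} (hα : 0 < α)
    (hαβ : α ≤ β) : ∃ C r : ℝ, 0 < C ∧ 0 < r ∧ (∀ x ∈ Icc α β, ∀ i < d, r ≤ x ^ (i + 1)) ∧
      ∀ N : ℕ, 1 ≤ N → ∀ t R : ℝ, 0 < t → t ≤ R / 4 → R ≤ r →
        volume {x | x ∈ Icc α β ∧ GenericIET d (powSum x) (T x) ∧
          ¬ NoIso d (powSum x) (T x) N t R} ≤ ENNReal.ofReal (C * (t / R)) := by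
  obtain ⟨Λ, hΛ, hΛ'⟩ := exists_powSum_sub_le β d
  set r := min 1 α ^ d with hr
  have hm0 : 0 < min 1 α := lt_min one_pos hα
  have hr0 : 0 < r := pow_pos hm0 d
  have hr1 : r ≤ 1 := pow_le_one₀ hm0.le (min_le_left _ _)
  have hrx : ∀ x ∈ Icc α β, ∀ i < d, r ≤ x ^ (i + 1) := by
    intro x hx i hi
    refine (pow_le_pow_of_le_one hm0.le (min_le_left _ _) (show i + 1 ≤ d by omega)).trans ?_
    exact pow_le_pow_left₀ hm0.le ((min_le_right _ _).trans hx.1) _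
  set E := 4 * β * (β / α) ^ d / (r / 2) with hE
  have hβ : 0 < β := by linarith
  have hE0 : 0 < E := by positivity
  set C₀ := 24 * Λ * E * (β - α + 1) with hC₀
  have hC0 : 0 < C₀ := by
    have : 0 < β - α + 1 := by linarith
    have : 0 < Λ := by linarith
    positivity
  refine ⟨d * (d * (2 * C₀)), r, by positivity, hr0, hrx, fun N hN t R ht htR hRr => ?_⟩
  have hR0 : 0 < R := by linarith
  have hgap : ∀ x ∈ Icc α β, ∀ i < d, R ≤ powSum x (i + 1) - powSum x i := by
    intro x hx i hi
    rw [powSum_succ, add_sub_cancel_left]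
    exact hRr.trans (hrx x hx i hi)
  have hc1 : ∀ x ∈ Icc α β, 2 * (r / 2) ≤ powSum x 1 := by
    intro x hx
    have := hrx x hx 0 (by omega)
    have e : powSum x 1 = x ^ (0 + 1) := by simp [powSum]
    linarith
  have hc2 : ∀ x ∈ Icc α β, 2 * (r / 2) ≤ powSum x d - powSum x (d - 1) := by
    intro x hx
    have := hrx x hx (d - 1) (by omega)
    rw [show powSum x d = powSum x (d - 1 + 1) by rw [show d - 1 + 1 = d by omega],
      powSum_succ]; linarith
  have hright : ∀ l < d, ∀ j, 1 ≤ j → j < d → volume {x | x ∈ Icc α β ∧ ∃ k, 1 ≤ k ∧ k ≤ N ∧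
      (GenericIET d (powSum x) (T x) ∧ IsoRight d (powSum x) (T x) t R l j k)} ≤
      ENNReal.ofReal (C₀ * (t / R)) := by
    intro l hl j hj1 hj
    refine volume_le_of_close hαβ hN hΛ hE0 ht hR0 (hRr.trans hr1) ?_
    rintro s hs s' hs' hss k k' hk hk' ⟨h1, h2⟩ ⟨h3, h4⟩ h5
    have hs0 : 0 < s := hα.trans_le hs.1
    refine sub_mul_le_of_ratio hα (by positivity) ht.le hs.1 hss hs'.2 ?_
    refine (twistPair_pow hd hs0 hss h1 h3).le_of_isoRight (hc1 s hs) (hc2 s hs) (by positivity)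
      hR0 htR (by linarith) (hgap s hs) hl hj1 hj hk hk' (le_trans ?_ h5) h2 h4
    exact mul_le_mul_of_nonneg_left (hΛ' s s' hs0 hss hs'.2) (by positivity)
  have hleft : ∀ l < d, ∀ j, 1 ≤ j → j < d → volume {x | x ∈ Icc α β ∧ ∃ k, 1 ≤ k ∧ k ≤ N ∧
      (GenericIET d (powSum x) (T x) ∧ IsoLeft d (powSum x) (T x) t R l j k)} ≤
      ENNReal.ofReal (C₀ * (t / R)) := by
    intro l hl j hj1 hj
    refine volume_le_of_close_neg hαβ hN hΛ hE0 ht hR0 (hRr.trans hr1) ?_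
    rintro s hs s' hs' hss k k' hk hk' ⟨h1, h2⟩ ⟨h3, h4⟩ h5
    have hs0 : 0 < s := hα.trans_le hs.1
    refine sub_mul_le_of_ratio hα (by positivity) ht.le hs.1 hss hs'.2 ?_
    refine (twistPair_pow hd hs0 hss h1 h3).le_of_isoLeft (hc1 s hs) (hc2 s hs) (by positivity)
      hR0 ht.le htR (hgap s hs) hl hj1 hj hk hk' (le_trans ?_ h5) h2 h4
    exact mul_le_mul_of_nonneg_left (hΛ' s s' hs0 hss hs'.2) (by positivity)
  set Y : ℕ → ℕ → Set ℝ := fun l j =>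
    {x | 1 ≤ j ∧ x ∈ Icc α β ∧ ∃ k, 1 ≤ k ∧ k ≤ N ∧ (GenericIET d (powSum x) (T x) ∧
      IsoRight d (powSum x) (T x) t R l j k)} ∪
    {x | 1 ≤ j ∧ x ∈ Icc α β ∧ ∃ k, 1 ≤ k ∧ k ≤ N ∧ (GenericIET d (powSum x) (T x) ∧
      IsoLeft d (powSum x) (T x) t R l j k)} with hY
  have hYv : ∀ l < d, ∀ j < d, volume (Y l j) ≤ ENNReal.ofReal (2 * C₀ * (t / R)) := by
    intro l hl j hj
    rcases Nat.eq_zero_or_pos j with rfl | hj1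
    · have : Y l 0 = ∅ := by simp [hY]
      simp [this]
    · refine (measure_union_le _ _).trans ?_
      rw [show 2 * C₀ * (t / R) = C₀ * (t / R) + C₀ * (t / R) by ring,
        ENNReal.ofReal_add (by positivity) (by positivity)]
      exact add_le_add ((measure_mono fun x hx => hx.2).trans (hright l hl j hj1 hj))
        ((measure_mono fun x hx => hx.2).trans (hleft l hl j hj1 hj))
  have hsub : {x | x ∈ Icc α β ∧ GenericIET d (powSum x) (T x) ∧
      ¬ NoIso d (powSum x) (T x) N t R} ⊆
      ⋃ l ∈ Finset.range d, ⋃ j ∈ Finset.range d, Y l j := by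
    rintro x ⟨hx, hg, hn⟩
    unfold NoIso at hn
    push Not at hn
    obtain ⟨l, hl, j, hj1, hj, k, hk1, hk, hn⟩ := hn
    simp only [mem_iUnion, Finset.mem_range]
    refine ⟨l, hl, j, hj, ?_⟩
    by_cases h : IsoRight d (powSum x) (T x) t R l j k
    · exact Or.inl ⟨hj1, hx, k, hk1, hk, hg, h⟩
    · exact Or.inr ⟨hj1, hx, k, hk1, hk, hg, hn h⟩
  refine (measure_mono hsub).trans ?_
  refine (measure_biUnion_finset_le _ _).trans ?_
  refine (Finset.sum_le_sum (g := fun _ => ENNReal.ofReal (d * (2 * C₀ * (t / R)))) ?_).trans ?_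
  · intro l hl
    refine (measure_biUnion_finset_le _ _).trans ?_
    refine (Finset.sum_le_sum (g := fun _ => ENNReal.ofReal (2 * C₀ * (t / R))) ?_).trans ?_
    · intro j hj
      exact hYv l (Finset.mem_range.1 hl) j (Finset.mem_range.1 hj)
    · rw [Finset.sum_const, Finset.card_range, nsmul_eq_mul, ENNReal.ofReal_mul (Nat.cast_nonneg d),
        ENNReal.ofReal_natCast]
  · rw [Finset.sum_const, Finset.card_range, nsmul_eq_mul,
      show (d * (d * (2 * C₀)) * (t / R) : ℝ) = d * (d * (2 * C₀ * (t / R))) by ring,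
      ENNReal.ofReal_mul (Nat.cast_nonneg d) (p := (d : ℝ)) (q := d * (2 * C₀ * (t / R))),
      ENNReal.ofReal_natCast]

theorem exists_volume_not_freeCover_le {d : ℕ} (hd : 2 ≤ d) (T : ℝ → ℝ → ℝ)
    (hm : ∀ x, 0 < x → Measurable (T x)) {α β : ℝ} (hα : 0 < α) (hαβ : α ≤ β) {η : ℝ}
    (hη : 0 < η) : ∃ c : ℝ, 0 < c ∧ ∀ n : ℕ,
      volume {x | x ∈ Icc α β ∧ GenericIET d (powSum x) (T x) ∧
        ¬ FreeCover d (powSum x) (T x) (n + 1) (c / (n + 1 : ℕ))} ≤ ENNReal.ofReal η := by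
  obtain ⟨C, r, hC, hr, hrx, hvol⟩ := exists_volume_iso_le hd T hα hαβ
  set K := max 4 (2 * d * C / η) with hK
  have hK4 : 4 ≤ K := le_max_left _ _
  have hKC : 2 * d * C / K ≤ η := by
    rw [div_le_iff₀ (by linarith), mul_comm η, ← div_le_iff₀ hη]
    exact le_max_right _ _
  have hd0 : (2 : ℝ) ≤ d := by exact_mod_cast hd
  have hK0 : 0 < K := by linarith
  set c := r / (d + 1) with hc
  have hc0 : 0 < c := by positivity
  have hcr : c ≤ r := div_le_self hr.le (by linarith)
  refine ⟨c / K ^ (2 * d), by positivity, fun n => ?_⟩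
  have hn : (1 : ℝ) ≤ ((n + 1 : ℕ) : ℝ) := by exact_mod_cast Nat.succ_pos n
  set ρ := c / ((n + 1 : ℕ) : ℝ) with hρ
  have hρ0 : 0 < ρ := by positivity
  have hρc : ρ ≤ c := div_le_self hc0.le hn
  have e1 : c / K ^ (2 * d) / ((n + 1 : ℕ) : ℝ) = ρ / K ^ (2 * d) := by rw [hρ, div_right_comm]
  have hsub : {x | x ∈ Icc α β ∧ GenericIET d (powSum x) (T x) ∧
        ¬ FreeCover d (powSum x) (T x) (n + 1) (c / K ^ (2 * d) / (n + 1 : ℕ))} ⊆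
      ⋃ s ∈ Finset.range (2 * d), {x | x ∈ Icc α β ∧ GenericIET d (powSum x) (T x) ∧
          ¬ NoIso d (powSum x) (T x) (n + 1) (ρ / K ^ (s + 1)) (ρ / K ^ s)} := by
    rintro x ⟨hx, hg, hn'⟩
    rw [e1] at hn'
    by_contra hcon
    simp only [mem_iUnion, Finset.mem_range, not_exists] at hcon
    refine hn' (hg.freeCover_of_levels (hm x (hα.trans_le hx.1)) (by linarith) hρ0 ?_ ?_ ?_)
    · intro i hi
      rw [powSum_succ, add_sub_cancel_left]
      linarith [hrx x hx i hi]
    · have h1 : r ≤ powSum x d := by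
        have h2 := hrx x hx 0 (by omega)
        have h3 := hg.le_of_le (show 0 + 1 ≤ d by omega) le_rfl
        rw [powSum_succ, powSum_zero, zero_add] at h3
        linarith
      refine le_trans ?_ h1
      have h2 : ρ * ((n + 1 : ℕ) : ℝ) = c := div_mul_cancel₀ _ (by positivity)
      have h3 : c * (d + 1) = r := div_mul_cancel₀ _ (by positivity)
      calc ρ * (((n + 1 : ℕ) : ℝ) * d + 1) = ρ * ((n + 1 : ℕ) : ℝ) * d + ρ := by ring
        _ ≤ c * (d + 1) := by rw [h2]; linarith
        _ = r := h3
    · intro s hs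
      by_contra hno
      exact hcon s hs ⟨hx, hg, hno⟩
  refine (measure_mono hsub).trans ((measure_biUnion_finset_le _ _).trans ?_)
  refine (Finset.sum_le_sum (g := fun _ => ENNReal.ofReal (C * (1 / K))) ?_).trans ?_
  · intro s hs
    have hKs : 0 < K ^ s := by positivity
    have h1 := hvol (n + 1) (by omega) (ρ / K ^ (s + 1)) (ρ / K ^ s) (by positivity) ?_ ?_
    · refine h1.trans_eq ?_
      congr 2
      rw [pow_succ]
      field_simp
    · rw [pow_succ, ← div_div]
      exact div_le_div_of_nonneg_left (by positivity) (by norm_num) hK4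
    · exact (div_le_self hρ0.le (one_le_pow₀ (by linarith))).trans (hρc.trans hcr)
  · rw [Finset.sum_const, Finset.card_range, nsmul_eq_mul, ← ENNReal.ofReal_natCast,
      ← ENNReal.ofReal_mul (Nat.cast_nonneg _)]
    refine ENNReal.ofReal_le_ofReal ?_
    push_cast
    refine le_trans (le_of_eq ?_) hKC
    ring

theorem ae_exists_frequently_freeCover {d : ℕ} (hd : 2 ≤ d) (T : ℝ → ℝ → ℝ)
    (hT : ∀ x, 0 < x → ReversingIET d (powSum x) (T x))
    (hm : ∀ x, 0 < x → Measurable (T x)) : ∀ᵐ x ∂(volume : Measure ℝ), 0 < x →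
      GenericIET d (powSum x) (T x) ∧ ∃ c : ℝ, 0 < c ∧
        ∃ᶠ n : ℕ in atTop, FreeCover d (powSum x) (T x) (n + 1) (c / (n + 1 : ℕ)) := by
  have hJ : ∀ M : ℕ, volume {x | x ∈ Icc (1 / ((M : ℝ) + 1)) (M + 1) ∧
      GenericIET d (powSum x) (T x) ∧ ∀ c : ℝ, 0 < c → ∃ n₀ : ℕ, ∀ n ≥ n₀,
        ¬ FreeCover d (powSum x) (T x) (n + 1) (c / (n + 1 : ℕ))} = 0 := by
    intro M
    refine le_antisymm (le_of_forall_pos_le_add fun η hη => ?_) zero_le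
    rw [zero_add]
    obtain ⟨η', hη', hle⟩ : ∃ η' : ℝ, 0 < η' ∧ ENNReal.ofReal η' ≤ η := by
      rcases eq_or_ne η ⊤ with rfl | hne
      · exact ⟨1, one_pos, le_top⟩
      · exact ⟨η.toReal, ENNReal.toReal_pos hη.ne' hne, ENNReal.ofReal_toReal_le⟩
    have hM : (0 : ℝ) < (M : ℝ) + 1 := by positivity
    obtain ⟨c, hc, hv⟩ := exists_volume_not_freeCover_le hd T hm (α := 1 / ((M : ℝ) + 1))
      (β := M + 1) (by positivity) (by
        rw [div_le_iff₀ hM]; nlinarith [Nat.cast_nonneg (α := ℝ) M]) hη'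
    refine le_trans ?_ hle
    set Z : ℕ → Set ℝ := fun n₀ => {x | x ∈ Icc (1 / ((M : ℝ) + 1)) (M + 1) ∧
      GenericIET d (powSum x) (T x) ∧ ∀ n ≥ n₀,
        ¬ FreeCover d (powSum x) (T x) (n + 1) (c / (n + 1 : ℕ))} with hZ
    have hmono : Monotone Z := fun i j hij x hx =>
      ⟨hx.1, hx.2.1, fun n hn => hx.2.2 n (hij.trans hn)⟩
    calc _ ≤ volume (⋃ i, Z i) := by
          refine measure_mono ?_
          rintro x ⟨hx, hg, h⟩
          obtain ⟨n₀, h0⟩ := h c hc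
          exact mem_iUnion.2 ⟨n₀, hx, hg, h0⟩
      _ = ⨆ i, volume (Z i) := hmono.measure_iUnion
      _ ≤ _ := iSup_le fun i => by
          refine le_trans (measure_mono ?_) (hv i)
          exact fun x hx => ⟨hx.1, hx.2.1, hx.2.2 i le_rfl⟩
  filter_upwards [ae_transcendental, ae_all_iff.2 fun M => measure_eq_zero_iff_ae_notMem.1 (hJ M)]
    with x hx hx2 hx0
  have hg := ReversingIET.generic_of_transcendental hd (hT x hx0) hx
  refine ⟨hg, ?_⟩
  by_contra hcon
  push Not at hcon
  obtain ⟨M, hM⟩ := exists_nat_ge (max x (1 / x))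
  refine hx2 M ⟨⟨?_, ?_⟩, hg, fun c hc => ?_⟩
  · have := (le_max_right x (1 / x)).trans hM
    rw [div_le_iff₀ hx0] at this
    rw [div_le_iff₀ (by positivity)]
    nlinarith
  · linarith [(le_max_left x (1 / x)).trans hM]
  · have := hcon c hc
    rw [eventually_atTop] at this
    exact this

namespace GenericIET
variable {d : ℕ} {b : ℕ → ℝ} {T : ℝ → ℝ} {N : ℕ} {R : ℝ}

theorem free_right_of_hit (hF : FreeCover d b T N R) {z : ℝ} (hz : z ∈ hitSet d b T N) :
    z + R ≤ b d ∧ FreeIoo d b T z (z + R) N := by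
  obtain ⟨h0, h1, m, hm, hb⟩ := hz
  obtain ⟨p, hp0, hpz, hzp, hpL, hp⟩ := hF z h0 h1
  have e : p = z := by
    by_contra hne
    exact hp z (lt_of_le_of_ne hpz hne) hzp m hm hb
  exact e ▸ ⟨hpL, hp⟩

theorem free_left_of_hit (h : GenericIET d b T) (hF : FreeCover d b T N R) {z : ℝ}
    (hz : z ∈ hitSet d b T N) : 0 ≤ z - R ∧ FreeIoo d b T (z - R) z N := by
  obtain ⟨h0, h1, m, hm, hb⟩ := hz
  have hz0 : 0 < z := by
    obtain ⟨j, hj1, hj, he⟩ := hb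
    exact h.pos_of_hit h0 hj1 hj he
  have key : ∀ u, 0 ≤ u → u < z → ∃ p, 0 ≤ p ∧ p + R ≤ z ∧ u < p + R ∧
      FreeIoo d b T p (p + R) N := by
    intro u hu0 huz
    obtain ⟨p, hp0, hpu, hup, -, hp⟩ := hF u hu0 (huz.trans h1)
    refine ⟨p, hp0, ?_, hup, hp⟩
    by_contra hc
    exact hp z (by linarith) (by linarith) m hm hb
  have h2 : 0 ≤ z - R := by
    obtain ⟨p, hp0, hpz, -⟩ := key 0 le_rfl hz0
    linarith
  refine ⟨h2, fun u hu1 hu2 => ?_⟩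
  obtain ⟨p, hp0, hpz, hup, hp⟩ := key u (by linarith) hu2
  exact hp u (by linarith) hup

theorem le_abs_return_sub (h : GenericIET d b T) (hF : FreeCover d b T N R) {q : ℕ} (hq : 1 ≤ q)
    (hqN : 2 * q ≤ N) {z : ℝ} (hz0 : 0 ≤ z) (hz1 : z < b d) : R ≤ |T^[q] z - z| := by
  by_contra hcon
  have hhit : ∀ m ≤ N, ∀ y ∈ hitSet d b T m, y ∈ hitSet d b T N :=
    fun m hm y ⟨h0, h1, n, hn, hb⟩ => ⟨h0, h1, n, by omega, hb⟩
  have hpull : ∀ y, 0 ≤ y → y < b d → T^[q] y ∈ hitSet d b T q → y ∈ hitSet d b T N := by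
    rintro y h0 h1 ⟨-, -, n, hn, hb⟩
    refine ⟨h0, h1, n + q, by omega, ?_⟩
    rwa [Function.iterate_add_apply]
  have hTz := h.iterate_mem hz0 hz1 q
  rcases lt_trichotomy (T^[q] z) z with hlt | heq | hgt
  · rw [abs_of_neg (by linarith)] at hcon
    set w := z - T^[q] z with hw
    have hfin : (hitSet d b T q ∩ Iic z ∪ {0}).Finite :=
      ((h.hitSet_finite q).inter_of_left _).union (finite_singleton 0)
    obtain ⟨e, he, hmax⟩ := hfin.exists_maximalFor id _ ⟨0, Or.inr rfl⟩
    have hez : 0 ≤ e ∧ e ≤ z := by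
      rcases he with he | rfl
      · exact ⟨he.1.1, he.2⟩
      · exact ⟨le_rfl, hz0⟩
    have hfree : FreeIoo d b T e z q := by
      rw [ReversingIET.freeIoo_iff hez.1 hz1.le]
      rintro y hy ⟨h1, h2⟩
      have := hmax (Or.inl ⟨hy, h2.le⟩) h1.le
      simp only [id] at this
      linarith
    have hTe : T^[q] e = e - w := by
      rcases hez.2.eq_or_lt with h1 | h1
      · rw [h1, hw]; ring
      have h2 := h.iterate_mem hez.1 (h1.trans hz1) q
      have hright : ∃ z' > z, z' ≤ b d ∧ FreeIoo d b T e z' q := by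
        by_cases hzh : z ∈ hitSet d b T q
        · have := hmax (Or.inl ⟨hzh, le_refl z⟩) hez.2
          simp only [id] at this
          linarith
        · obtain ⟨p, hp0, hpz, hzp, hpL, hp⟩ := hF z hz0 hz1
          refine ⟨p + R, hzp, hpL, ?_⟩
          refine freeIoo_across hfree (hp.mono hpz le_rfl (by omega)) fun m hm hb => ?_
          exact hzh ⟨hz0, hz1, m, hm, hb⟩
      obtain ⟨z', hz', hz'L, hf⟩ := hright
      have := h.iterate_add hez.1 hz'L hf le_rfl hez.2 hz'
      linarith
    have he0 : e ∈ hitSet d b T q := by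
      rcases he with he | rfl
      · exact he.1
      · have := (h.iterate_mem le_rfl h.L_pos q).1
        linarith
    have hr := free_right_of_hit hF (hhit q (by omega) e he0)
    have hadd := h.iterate_add hez.1 hr.1 hr.2 (show q ≤ N by omega)
      (show e ≤ e + w by linarith) (by linarith)
    have hmem := hpull (e + w) (by linarith) (by linarith [hr.1])
      (by rw [hadd, hTe, show e - w + (e + w - e) = e by ring]; exact he0)
    obtain ⟨-, -, m, hm, hb⟩ := hmem
    exact hr.2 (e + w) (by linarith) (by linarith) m hm hb
  · exact h.no_per z hz0 hz1 q hq heq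
  · rw [abs_of_pos (by linarith)] at hcon
    set w := T^[q] z - z with hw
    have hfin : (hitSet d b T q ∩ Ioi z ∪ {b d}).Finite :=
      ((h.hitSet_finite q).inter_of_left _).union (finite_singleton _)
    obtain ⟨f, hf, hmin⟩ := hfin.exists_minimalFor id _ ⟨b d, Or.inr rfl⟩
    have hfz : z < f ∧ f ≤ b d := by
      rcases hf with hf | rfl
      · exact ⟨hf.2, hf.1.2.1.le⟩
      · exact ⟨hz1, le_rfl⟩
    have hfree : FreeIoo d b T z f q := by
      rw [ReversingIET.freeIoo_iff hz0 hfz.2]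
      rintro y hy ⟨h1, h2⟩
      have := hmin (Or.inl ⟨hy, h1⟩) h2.le
      simp only [id] at this
      linarith
    obtain ⟨p, hp0, hpz, hzp, hpL, hp⟩ := hF z hz0 hz1
    have hpf : p + R ≤ f := by
      by_contra hc
      rcases hf with ⟨⟨-, -, m, hm, hb⟩, -⟩ | rfl
      · exact hp f (by linarith) (by linarith) m (by omega) hb
      · linarith
    have hfree' : FreeIoo d b T p f q := by
      intro u hu1 hu2
      rcases lt_or_ge u (p + R) with h1 | h1
      · exact fun m hm => hp u hu1 h1 m (by omega)
      · exact hfree u (by linarith) hu2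
    have e1 := h.iterate_add hp0 hfz.2 hfree' le_rfl hpz hfz.1
    have e2 := h.iterate_add hp0 hfz.2 hfree' le_rfl (show p ≤ f - w by linarith) (by linarith)
    have e3 : T^[q] (f - w) = f := by linarith
    have hfw : 0 ≤ f - w ∧ f - w < b d := ⟨by linarith, by linarith [hfz.2]⟩
    rcases hf with hf | rfl
    · obtain ⟨-, -, m, hm, hb⟩ := hpull (f - w) hfw.1 hfw.2 (by rw [e3]; exact hf.1)
      exact (h.free_left_of_hit hF (hhit q (by omega) f hf.1)).2 (f - w) (by linarith)
        (by linarith) m hm hb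
    · linarith [(h.iterate_mem hfw.1 hfw.2 q).2]

theorem exists_free_translate (h : GenericIET d b T) (hF : FreeCover d b T N R) {M : ℕ}
    (hM : 2 * M ≤ N) {y w : ℝ} (hy : 0 ≤ y) (hyw : y + w ≤ b d) (hwR : w ≤ R) :
    ∃ y', 0 ≤ y' ∧ y' + w ≤ b d ∧ FreeIoo d b T y' (y' + w) M ∧ ∃ r ≤ M, T^[r] y' = y := by
  by_cases hfree : FreeIoo d b T y (y + w) M
  · exact ⟨y, hy, hyw, hfree, 0, by omega, rfl⟩
  rw [ReversingIET.freeIoo_iff hy hyw] at hfree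
  push Not at hfree
  obtain ⟨e, ⟨he0, he1, m, hm, j, hj1, hj, hb⟩, h1, h2⟩ := hfree
  obtain ⟨z, hz0, hz1, hz⟩ := h.iterate_surj he0 he1 M
  have hb' : T^[m + M] z = b j := by rw [Function.iterate_add_apply, hz, hb]
  have hzN : z ∈ hitSet d b T N := ⟨hz0, hz1, m + M, by omega, j, hj1, hj, hb'⟩
  have hl := h.free_left_of_hit hF hzN
  have hr := free_right_of_hit hF hzN
  have hf : FreeIoo d b T (z - R) (z + R) M :=
    freeIoo_across (hl.2.mono le_rfl le_rfl (by omega)) (hr.2.mono le_rfl le_rfl (by omega))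
      fun i hi => h.not_break_before hj1 hj hb' (by omega)
  refine ⟨z - (e - y), by linarith, by linarith [hr.1],
    hf.mono (by linarith) (by linarith) le_rfl, M, le_rfl, ?_⟩
  have e1 := h.iterate_add hl.1 hr.1 hf le_rfl (show z - R ≤ z by linarith) (by linarith)
  have e2 := h.iterate_add hl.1 hr.1 hf le_rfl (show z - R ≤ z - (e - y) by linarith)
    (by linarith)
  linarith

theorem disjoint_tower (h : GenericIET d b T) (hF : FreeCover d b T N R) {M : ℕ}
    (hM : 2 * M ≤ N) {y w : ℝ} (hy : 0 ≤ y) (hyw : y + w ≤ b d) (hwR : w ≤ R)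
    (hfree : FreeIoo d b T y (y + w) M) {k k' : ℕ} (hk : k < k') (hk' : k' < M) :
    Disjoint (Ico (T^[k] y) (T^[k] y + w)) (Ico (T^[k'] y) (T^[k'] y + w)) := by
  rw [Set.disjoint_left]
  rintro u ⟨h1, h2⟩ ⟨h3, h4⟩
  have e1 := h.iterate_add hy hyw hfree (show k ≤ M by omega)
    (show y ≤ y + (u - T^[k] y) by linarith) (by linarith)
  have e2 := h.iterate_add hy hyw hfree (show k' ≤ M by omega)
    (show y ≤ y + (u - T^[k'] y) by linarith) (by linarith)
  set a := y + (u - T^[k] y) with ha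
  set a' := y + (u - T^[k'] y) with ha'
  have hq := h.iterate_mem (show 0 ≤ a' by linarith) (show a' < b d by linarith) (k' - k)
  have e3 : T^[k] (T^[k' - k] a') = T^[k] a := by
    rw [← Function.iterate_add_apply, Nat.add_sub_cancel' hk.le, e1, e2, ha, ha']; ring
  have e4 := h.iterate_inj hq.1 hq.2 (by linarith) (by linarith) k e3
  have := h.le_abs_return_sub hF (show 1 ≤ k' - k by omega) (by omega)
    (show 0 ≤ a' by linarith) (by linarith)
  rw [e4] at this
  have h5 : |a - a'| < w := by rw [abs_lt]; constructor <;> linarith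
  linarith

theorem measure_tower (h : ReversingIET d b T) {ν : Measure ℝ} (hν : MeasurePreserving T ν ν)
    (hν0 : ν (Ico 0 (b d))ᶜ = 0) {M : ℕ} {y w : ℝ} (hy : 0 ≤ y) (hyw : y + w ≤ b d)
    (hfree : FreeIoo d b T y (y + w) M) {k : ℕ} (hk : k ≤ M) :
    ν (Ico (T^[k] y) (T^[k] y + w)) = ν (Ico y (y + w)) := by
  rw [← (hν.iterate k).measure_preimage measurableSet_Ico.nullMeasurableSet,
    ← measure_inter_conull hν0, ← measure_inter_conull (s := Ico y (y + w)) hν0]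
  congr 1
  ext u
  simp only [mem_inter_iff, mem_preimage, mem_Ico]
  refine and_congr_left fun ⟨h0, h1⟩ => ?_
  constructor
  · rintro ⟨h2, h3⟩
    have e := h.iterate_add hy hyw hfree hk (show y ≤ y + (T^[k] u - T^[k] y) by linarith)
      (by linarith)
    rw [add_sub_cancel_left, add_sub_cancel] at e
    have := h.iterate_inj (by linarith) (by linarith) h0 h1 k e
    constructor <;> linarith
  · rintro ⟨h2, h3⟩
    have e := h.iterate_add hy hyw hfree hk h2 h3
    constructor <;> linarith

end GenericIET

namespace GenericIET
variable {d : ℕ} {b : ℕ → ℝ} {T : ℝ → ℝ} {N : ℕ} {R : ℝ}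

theorem le_of_freeCover (h : ReversingIET d b T) (hF : FreeCover d b T N R) : R ≤ b d := by
  obtain ⟨p, hp, -, -, hpL, -⟩ := hF 0 le_rfl h.L_pos
  linarith

theorem measurableSet_tower {y w : ℝ} (M : ℕ) :
    MeasurableSet (⋃ k ∈ Finset.range M, Ico (T^[k] y) (T^[k] y + w)) :=
  Finset.measurableSet_biUnion _ fun _ _ => measurableSet_Ico

theorem measure_iUnion_tower (h : GenericIET d b T) (hF : FreeCover d b T N R) {M : ℕ}
    (hM : 2 * M ≤ N) {ν : Measure ℝ} (hν : MeasurePreserving T ν ν)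
    (hν0 : ν (Ico 0 (b d))ᶜ = 0) {y w : ℝ} (hy : 0 ≤ y) (hyw : y + w ≤ b d) (hwR : w ≤ R)
    (hfree : FreeIoo d b T y (y + w) M) :
    ν (⋃ k ∈ Finset.range M, Ico (T^[k] y) (T^[k] y + w)) = M * ν (Ico y (y + w)) := by
  rw [measure_biUnion_finset _ fun _ _ => measurableSet_Ico]
  · rw [Finset.sum_congr rfl fun k hk => measure_tower h.toReversingIET hν hν0 hy hyw hfree
      (Finset.mem_range.1 hk).le]
    simp
  · intro k hk k' hk' hne
    simp only [Finset.coe_range, mem_Iio] at hk hk'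
    rcases lt_or_gt_of_ne hne with hlt | hlt
    · exact h.disjoint_tower hF hM hy hyw hwR hfree hlt hk'
    · exact (h.disjoint_tower hF hM hy hyw hwR hfree hlt hk).symm

theorem measure_Ico_le (h : GenericIET d b T) (hF : FreeCover d b T N R) {M : ℕ}
    (hM : 2 * M ≤ N) {ν : Measure ℝ} [IsProbabilityMeasure ν] (hν : MeasurePreserving T ν ν)
    (hν0 : ν (Ico 0 (b d))ᶜ = 0) (y : ℝ) :
    M * ν.real (Ico y (y + R)) ≤ 1 := by
  have main : ∀ y, 0 ≤ y → y + R ≤ b d → M * ν.real (Ico y (y + R)) ≤ 1 := by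
    intro y hy hyR
    obtain ⟨y', hy', hyR', hfree, r, hr, hry⟩ := h.exists_free_translate hF hM hy hyR le_rfl
    rw [← hry, Measure.real, measure_tower h.toReversingIET hν hν0 hy' hyR' hfree hr]
    have := h.measure_iUnion_tower hF hM hν hν0 hy' hyR' le_rfl hfree
    have h1 := congrArg ENNReal.toReal this
    rw [ENNReal.toReal_mul, ENNReal.toReal_natCast] at h1
    rw [← h1]
    exact measureReal_le_one
  have hR := le_of_freeCover h.toReversingIET hF
  have h1 := main (max 0 (min y (b d - R))) (le_max_left _ _) (by
    have : max 0 (min y (b d - R)) ≤ b d - R := max_le (by linarith) (min_le_right _ _)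
    linarith)
  refine le_trans (mul_le_mul_of_nonneg_left ?_ (Nat.cast_nonneg M)) h1
  rw [Measure.real, ← measure_inter_conull hν0]
  refine measureReal_mono ?_
  rintro u ⟨⟨h2, h3⟩, h4, h5⟩
  constructor
  · exact max_le h4 ((min_le_left _ _).trans h2)
  · rcases min_cases y (b d - R) with ⟨h6, -⟩ | ⟨h6, -⟩
    · rw [h6]
      linarith [le_max_right 0 y]
    · rw [h6]
      linarith [le_max_right 0 (b d - R)]

theorem measure_Ioc_le (h : GenericIET d b T) (hF : FreeCover d b T N R) (hR : 0 < R) {M : ℕ}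
    (hM : 2 * M ≤ N) (hM1 : 1 ≤ M) {ν : Measure ℝ} [IsProbabilityMeasure ν]
    (hν : MeasurePreserving T ν ν) (hν0 : ν (Ico 0 (b d))ᶜ = 0) {u v : ℝ} (huv : u ≤ v) :
    ν.real (Ioc u v) ≤ ((v - u) / R + 1) / M := by
  have hM0 : (0 : ℝ) < M := by exact_mod_cast hM1
  set n := ⌊(v - u) / R⌋₊ + 1 with hn
  have hsub : Ioc u v ⊆ ⋃ i ∈ Finset.range n, Ico (u + i * R) (u + i * R + R) := by
    rintro t ⟨h1, h2⟩
    have h3 : 0 ≤ (t - u) / R := div_nonneg (by linarith) hR.le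
    simp only [mem_iUnion, Finset.mem_range]
    refine ⟨⌊(t - u) / R⌋₊, ?_, ?_, ?_⟩
    · exact Nat.lt_succ_of_le (Nat.floor_mono (by gcongr))
    · have := Nat.floor_le h3
      rw [le_div_iff₀ hR] at this
      linarith
    · have := Nat.lt_floor_add_one ((t - u) / R)
      rw [div_lt_iff₀ hR] at this
      linarith
  calc ν.real (Ioc u v) ≤ ν.real (⋃ i ∈ Finset.range n, Ico (u + i * R) (u + i * R + R)) :=
        measureReal_mono hsub (measure_ne_top _ _)
    _ ≤ ∑ i ∈ Finset.range n, ν.real (Ico (u + i * R) (u + i * R + R)) :=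
        measureReal_biUnion_finset_le _ _
    _ ≤ ∑ i ∈ Finset.range n, (1 : ℝ) / M := Finset.sum_le_sum fun i _ => by
        rw [le_div_iff₀ hM0, mul_comm]
        exact h.measure_Ico_le hF hM hν hν0 _
    _ = n / M := by simp [div_eq_mul_inv]
    _ ≤ ((v - u) / R + 1) / M := by
        gcongr
        rw [hn]
        push_cast
        have := Nat.floor_le (div_nonneg (sub_nonneg.2 huv) hR.le)
        linarith

theorem measure_Ioc_le_mul (h : GenericIET d b T) {c : ℝ} (hc : 0 < c)
    (hF : ∃ᶠ n : ℕ in atTop, FreeCover d b T (n + 1) (c / (n + 1 : ℕ)))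
    {ν : Measure ℝ} [IsProbabilityMeasure ν]
    (hν : MeasurePreserving T ν ν) (hν0 : ν (Ico 0 (b d))ᶜ = 0) {u v : ℝ} (huv : u ≤ v) :
    ν.real (Ioc u v) ≤ 4 / c * (v - u) := by
  have hlim : Tendsto (fun n : ℕ => 4 / c * (v - u) + 4 * (1 / ((n : ℝ) + 1))) atTop
      (nhds (4 / c * (v - u) + 4 * 0)) :=
    tendsto_const_nhds.add (tendsto_one_div_add_atTop_nhds_zero_nat.const_mul _)
  rw [mul_zero, add_zero] at hlim
  refine ge_of_tendsto_of_frequently hlim ((hF.and_eventually (eventually_ge_atTop 1)).mono ?_)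
  rintro n ⟨hn, hn1⟩
  have hn0 : (0 : ℝ) < (n : ℝ) + 1 := by positivity
  have h1 := h.measure_Ioc_le hn (by positivity) (M := (n + 1) / 2) (by omega) (by omega)
    hν hν0 huv
  refine h1.trans ?_
  have h2 : ((n : ℝ) + 1) / 4 ≤ (((n + 1) / 2 : ℕ) : ℝ) := by
    have : n + 1 ≤ 4 * ((n + 1) / 2) := by omega
    have : ((n + 1 : ℕ) : ℝ) ≤ ((4 * ((n + 1) / 2) : ℕ) : ℝ) := by exact_mod_cast this
    push_cast at this
    linarith
  have hvu := sub_nonneg.2 huv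
  calc ((v - u) / (c / (n + 1 : ℕ)) + 1) / (((n + 1) / 2 : ℕ) : ℝ)
      ≤ ((v - u) / (c / (n + 1 : ℕ)) + 1) / (((n : ℝ) + 1) / 4) := by
        gcongr
    _ = 4 / c * (v - u) + 4 * (1 / ((n : ℝ) + 1)) := by
        push_cast
        field_simp

end GenericIET

theorem absolutelyContinuous_volume_of_Ioc_le {ν : Measure ℝ} [IsFiniteMeasure ν] {C : ℝ}
    (hC : 0 ≤ C) (h : ∀ u v, u ≤ v → ν.real (Ioc u v) ≤ C * (v - u)) :
    ν ≪ (volume : Measure ℝ) := by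
  let f : StieltjesFunction ℝ := C.toNNReal • StieltjesFunction.id
  have hf : ∀ x, f x = C * x := fun x => by
    change ((C.toNNReal : ℝ)) * x = C * x
    rw [Real.coe_toNNReal _ hC]
  have hle : ν.toOuterMeasure ≤ f.outer := by
    refine OuterMeasure.le_ofFunction.2 fun s => ?_
    rw [StieltjesFunction.length_eq]
    refine le_iInf fun u => le_iInf fun v => le_iInf fun hs => ?_
    have hbot : (botSet : Set ℝ) = ∅ := by
      ext x
      simp [botSet]
    rw [hbot, sdiff_empty] at hs
    refine (measure_mono hs).trans ?_
    rcases le_total u v with huv | huv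
    · rw [hf, hf, ← mul_sub]
      exact (ENNReal.le_ofReal_iff_toReal_le (measure_ne_top ν _)
        (mul_nonneg hC (sub_nonneg.2 huv))).2 (h u v huv)
    · simp [Ioc_eq_empty_of_le huv]
  intro s hs
  have h1 : f.measure s = 0 := by
    rw [StieltjesFunction.measure_smul, ← Real.volume_eq_stieltjes_id, Measure.smul_apply, hs,
      smul_zero]
  refine le_antisymm ((hle s).trans ?_) bot_le
  rw [StieltjesFunction.measure] at h1
  exact h1.le

theorem ae_tendsto_density (A : Set ℝ) : ∀ᵐ x ∂(volume : Measure ℝ).restrict A,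
    ∀ {ι : Type} {l : Filter ι} (u w : ι → ℝ), Tendsto w l (nhdsWithin 0 (Ioi 0)) →
      (∀ᶠ j in l, u j ≤ x ∧ x ≤ u j + w j) →
      Tendsto (fun j => volume.real (A ∩ Ico (u j) (u j + w j)) / w j) l (nhds 1) := by
  filter_upwards [IsUnifLocDoublingMeasure.ae_tendsto_measure_inter_div
    (volume : Measure ℝ) A 1] with x hx ι l u w hw hxm
  have hw2 : Tendsto (fun j => w j / 2) l (nhdsWithin 0 (Ioi 0)) := by
    rw [tendsto_nhdsWithin_iff] at hw ⊢
    refine ⟨by simpa using hw.1.div_const 2, hw.2.mono fun j hj => ?_⟩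
    exact half_pos (mem_Ioi.1 hj)
  have h1 := hx (fun j => u j + w j / 2) (fun j => w j / 2) hw2 (hxm.mono fun j hj => by
    rw [Real.closedBall_eq_Icc]
    constructor <;> linarith [hj.1, hj.2])
  have h2 := (ENNReal.tendsto_toReal ENNReal.one_ne_top).comp h1
  rw [ENNReal.toReal_one] at h2
  refine h2.congr' ?_
  filter_upwards [(tendsto_nhdsWithin_iff.1 hw).2] with j hj
  have hj0 : 0 < w j := hj
  simp only [Function.comp_apply, Real.closedBall_eq_Icc, ENNReal.toReal_div]
  rw [show u j + w j / 2 - w j / 2 = u j by ring,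
    show u j + w j / 2 + w j / 2 = u j + w j by ring, Real.volume_Icc, add_sub_cancel_left,
    ENNReal.toReal_ofReal hj0.le, Measure.real]
  congr 2
  exact measure_congr ((ae_eq_refl A).inter Ico_ae_eq_Icc.symm)

theorem volume_real_inter_Ico_add_compl {A : Set ℝ} (hA : MeasurableSet A) {u w : ℝ}
    (hw : 0 ≤ w) :
    volume.real (A ∩ Ico u (u + w)) + volume.real (Aᶜ ∩ Ico u (u + w)) = w := by
  have h := measureReal_inter_add_sdiff (μ := volume) (s := Ico u (u + w)) hA
    (by simp)
  rw [inter_comm A, inter_comm Aᶜ, ← sdiff_eq, h]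
  simp [hw]

theorem continuous_volume_real_inter_Ico {A : Set ℝ} (hA : MeasurableSet A) {w : ℝ}
    (hw : 0 ≤ w) : Continuous fun u => volume.real (A ∩ Ico u (u + w)) := by
  have hint : ∀ p q : ℝ, IntervalIntegrable (A.indicator fun _ => (1 : ℝ)) volume p q :=
    fun p q => by
      have h : IntervalIntegrable (fun _ => (1 : ℝ)) volume p q := intervalIntegrable_const
      exact ⟨h.1.indicator hA, h.2.indicator hA⟩
  have hF := intervalIntegral.continuous_primitive hint 0
  have e : (fun u => volume.real (A ∩ Ico u (u + w))) = fun u =>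
      (∫ x in (0 : ℝ)..(u + w), A.indicator (fun _ => (1 : ℝ)) x) -
        ∫ x in (0 : ℝ)..u, A.indicator (fun _ => (1 : ℝ)) x := by
    funext u
    rw [intervalIntegral.integral_interval_sub_left (hint _ _) (hint _ _),
      intervalIntegral.integral_of_le (by linarith), integral_indicator hA,
      Measure.restrict_restrict hA]
    simp only [integral_const, smul_eq_mul, mul_one, measureReal_restrict_apply_univ]
    exact measureReal_congr ((ae_eq_refl A).inter Ico_ae_eq_Ioc)
  rw [e]
  exact (hF.comp (continuous_id.add continuous_const)).sub hF

theorem eventually_exists_half_interval {A : Set ℝ} (hA : MeasurableSet A) {L : ℝ}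
    (h0 : volume (A ∩ Ico 0 L) ≠ 0) (h1 : volume (Aᶜ ∩ Ico 0 L) ≠ 0) :
    ∀ᶠ w in nhdsWithin (0 : ℝ) (Ioi 0), ∃ y, 0 ≤ y ∧ y + w ≤ L ∧
      volume.real (A ∩ Ico y (y + w)) = w / 2 := by
  have key : ∀ B : Set ℝ, volume (B ∩ Ico 0 L) ≠ 0 → ∃ y, 0 ≤ y ∧
      ∀ᶠ w in nhdsWithin (0 : ℝ) (Ioi 0), y + w ≤ L ∧
        w / 2 < volume.real (B ∩ Ico y (y + w)) := by
    intro B hB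
    have hae := ae_restrict_of_ae_restrict_of_subset (inter_subset_left (s := B) (t := Ico 0 L))
      (ae_tendsto_density B)
    have hne : (ae ((volume : Measure ℝ).restrict (B ∩ Ico 0 L))).NeBot := by
      rw [ae_neBot]
      exact fun h => hB (Measure.restrict_eq_zero.1 h)
    have hmem : ∀ᵐ x ∂(volume : Measure ℝ).restrict (B ∩ Ico 0 L), x ∈ Ico 0 L :=
      ae_restrict_of_ae_restrict_of_subset inter_subset_right
        (ae_restrict_mem measurableSet_Ico)
    obtain ⟨y, hy, hy0, hyL⟩ := (hae.and hmem).exists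
    refine ⟨y, hy0, ?_⟩
    have hlim := hy (fun _ : ℝ => y) (fun w => w) tendsto_id (by
      filter_upwards [self_mem_nhdsWithin] with w hw
      have : 0 < w := hw
      exact ⟨le_rfl, by linarith⟩)
    have hsmall : ∀ᶠ w in nhdsWithin (0 : ℝ) (Ioi 0), w < L - y :=
      (eventually_lt_nhds (sub_pos.2 hyL)).filter_mono nhdsWithin_le_nhds
    filter_upwards [hsmall, hlim.eventually_const_lt (show (1 / 2 : ℝ) < 1 by norm_num),
      self_mem_nhdsWithin] with w h2 h3 h4
    have hw0 : 0 < w := h4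
    refine ⟨by linarith, ?_⟩
    rw [lt_div_iff₀ hw0] at h3
    linarith
  obtain ⟨y0, hy0, hv0⟩ := key A h0
  obtain ⟨y1, hy1, hv1⟩ := key Aᶜ h1
  filter_upwards [hv0, hv1, self_mem_nhdsWithin] with w h2 h3 h4
  have hw0 : 0 < w := h4
  have hs := volume_real_inter_Ico_add_compl hA (u := y1) hw0.le
  obtain ⟨y, hy, hyw⟩ := intermediate_value_uIcc (a := y1) (b := y0)
    (continuous_volume_real_inter_Ico hA hw0.le).continuousOn
    (show w / 2 ∈ uIcc _ _ from Icc_subset_uIcc ⟨by linarith [h3.2], h2.2.le⟩)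
  refine ⟨y, (le_min hy1 hy0).trans hy.1, ?_, hyw⟩
  have : max y1 y0 ≤ L - w := max_le (by linarith [h3.1]) (by linarith [h2.1])
  linarith [hy.2]

theorem le_measure_frequently {α : Type*} [MeasurableSpace α] {μ : Measure α} [IsFiniteMeasure μ]
    {E : ℕ → Set α} (hE : ∀ n, MeasurableSet (E n)) {δ : ENNReal}
    (h : ∃ᶠ n in atTop, δ ≤ μ (E n)) : δ ≤ μ {x | ∃ᶠ n in atTop, x ∈ E n} := by
  have e : {x | ∃ᶠ n in atTop, x ∈ E n} = ⋂ m : ℕ, ⋃ n ≥ m, E n := by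
    ext x
    simp [frequently_atTop]
  have hlim := tendsto_measure_iInter_atTop (μ := μ) (s := fun m : ℕ => ⋃ n ≥ m, E n)
    (fun m => (MeasurableSet.biUnion (to_countable _) fun n _ => hE n).nullMeasurableSet)
    (fun m m' hm => biUnion_mono (fun n hn => le_trans hm hn) fun _ _ => le_rfl)
    ⟨0, measure_ne_top _ _⟩
  rw [e]
  refine ge_of_tendsto' hlim fun m => ?_
  obtain ⟨n, hn, hδ⟩ := frequently_atTop.1 h m
  exact hδ.trans (measure_mono (subset_biUnion_of_mem (u := E) hn))

namespace GenericIET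
variable {d : ℕ} {b : ℕ → ℝ} {T : ℝ → ℝ} {N : ℕ} {R : ℝ}

theorem exists_half_tower (h : GenericIET d b T) (hm : Measurable T) (hF : FreeCover d b T N R)
    (hR : 0 < R) {M : ℕ} (hM : 2 * M ≤ N) {A : Set ℝ} (hA : MeasurableSet A)
    (hTA : T ⁻¹' A = A) {y : ℝ} (hy : 0 ≤ y) (hyR : y + R ≤ b d)
    (hhalf : volume.real (A ∩ Ico y (y + R)) = R / 2) :
    ∃ E : Set ℝ, MeasurableSet E ∧
      ENNReal.ofReal (M * R) ≤ volume.restrict (Ico 0 (b d)) E ∧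
      ∀ x ∈ E, ∃ u, u ≤ x ∧ x ≤ u + R ∧ volume.real (A ∩ Ico u (u + R)) = R / 2 := by
  obtain ⟨y', hy', hyR', hfree, r, hr, hry⟩ := h.exists_free_translate hF hM hy hyR le_rfl
  have hmp := h.toReversingIET.measurePreserving hm
  have hmpA : MeasurePreserving T ((volume.restrict (Ico 0 (b d))).restrict A)
      ((volume.restrict (Ico 0 (b d))).restrict A) := by
    have := hmp.restrict_preimage hA
    rwa [hTA] at this
  have hc0 : volume.restrict (Ico 0 (b d)) (Ico 0 (b d))ᶜ = 0 := by
    rw [Measure.restrict_apply measurableSet_Ico.compl, compl_inter_self, measure_empty]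
  have hcA : (volume.restrict (Ico 0 (b d))).restrict A (Ico 0 (b d))ᶜ = 0 :=
    le_antisymm ((Measure.restrict_apply_le _ _).trans hc0.le) bot_le
  have hval : ∀ u, 0 ≤ u → u + R ≤ b d → volume.real (A ∩ Ico u (u + R)) =
      ((volume.restrict (Ico 0 (b d))).restrict A (Ico u (u + R))).toReal := by
    intro u hu huR
    rw [Measure.restrict_apply measurableSet_Ico,
      Measure.restrict_apply (measurableSet_Ico.inter hA), Measure.real, inter_comm A]
    congr 2
    ext t
    simp only [mem_inter_iff, mem_Ico]
    constructor
    · rintro ⟨⟨h1, h2⟩, h3⟩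
      exact ⟨⟨⟨h1, h2⟩, h3⟩, by linarith, by linarith⟩
    · exact fun ht => ht.1
  have hlevel : ∀ k ≤ M, 0 ≤ T^[k] y' ∧ T^[k] y' + R ≤ b d := by
    intro k hk
    refine ⟨(h.iterate_mem hy' (by linarith) k).1, ?_⟩
    by_contra hcon
    push Not at hcon
    have h1 := h.iterate_mem (show 0 ≤ y' by linarith) (by linarith) k
    have e := h.iterate_add hy' hyR' hfree hk (show y' ≤ y' + (b d - T^[k] y') by linarith)
      (by linarith)
    have h2 := h.iterate_mem (show 0 ≤ y' + (b d - T^[k] y') by linarith) (by linarith) k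
    linarith
  refine ⟨⋃ k ∈ Finset.range M, Ico (T^[k] y') (T^[k] y' + R), measurableSet_tower M, ?_, ?_⟩
  · rw [h.measure_iUnion_tower hF hM hmp hc0 hy' hyR' le_rfl hfree,
      Measure.restrict_apply measurableSet_Ico,
      inter_eq_left.2 (Ico_subset_Ico hy' hyR'), Real.volume_Ico, add_sub_cancel_left,
      ENNReal.ofReal_mul (Nat.cast_nonneg M), ENNReal.ofReal_natCast]
  · intro x hx
    simp only [mem_iUnion, Finset.mem_range] at hx
    obtain ⟨k, hk, hx1, hx2⟩ := hx
    refine ⟨T^[k] y', hx1, hx2.le, ?_⟩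
    have hl := hlevel k hk.le
    rw [hval _ hl.1 hl.2, measure_tower h.toReversingIET hmpA hcA hy' hyR' hfree hk.le,
      ← measure_tower h.toReversingIET hmpA hcA hy' hyR' hfree hr, hry, ← hval y hy hyR, hhalf]

theorem ergodic (h : GenericIET d b T) (hm : Measurable T) {c : ℝ} (hc : 0 < c)
    (hF : ∃ᶠ n : ℕ in atTop, FreeCover d b T (n + 1) (c / (n + 1 : ℕ))) :
    Ergodic T (volume.restrict (Ico 0 (b d))) := by
  refine { h.toReversingIET.measurePreserving hm with aeconst_set := fun A hA hTA => ?_ }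
  by_contra hcon
  rw [eventuallyConst_set'] at hcon
  push Not at hcon
  have h0 : volume (A ∩ Ico 0 (b d)) ≠ 0 := by
    rw [← Measure.restrict_apply hA]
    exact fun hz => hcon.1 (ae_eq_empty.2 hz)
  have h1 : volume (Aᶜ ∩ Ico 0 (b d)) ≠ 0 := by
    rw [← Measure.restrict_apply hA.compl]
    exact fun hz => hcon.2 (ae_eq_univ.2 hz)
  have hRlim : Tendsto (fun n : ℕ => c / (n + 1 : ℕ)) atTop (nhdsWithin 0 (Ioi 0)) := by
    rw [tendsto_nhdsWithin_iff]
    refine ⟨?_, Eventually.of_forall fun n => mem_Ioi.2 (by positivity)⟩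
    exact (tendsto_const_nhds.div_atTop tendsto_natCast_atTop_atTop).comp (tendsto_add_atTop_nat 1)
  have hfreq : ∃ᶠ n : ℕ in atTop, ∃ E : Set ℝ, MeasurableSet E ∧
      ENNReal.ofReal (c / 4) ≤ volume.restrict (Ico 0 (b d)) E ∧
      ∀ x ∈ E, ∃ u, u ≤ x ∧ x ≤ u + c / (n + 1 : ℕ) ∧
        volume.real (A ∩ Ico u (u + c / (n + 1 : ℕ))) = c / (n + 1 : ℕ) / 2 := by
    refine (hF.and_eventually ((hRlim.eventually
      (eventually_exists_half_interval hA h0 h1)).and (eventually_ge_atTop 1))).mono ?_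
    rintro n ⟨hFn, ⟨y, hy, hyR, hhalf⟩, hn⟩
    have hR : 0 < c / (n + 1 : ℕ) := by positivity
    obtain ⟨E, hE, hEm, hEx⟩ := h.exists_half_tower hm hFn hR (M := (n + 1) / 2) (by omega)
      hA hTA hy hyR hhalf
    refine ⟨E, hE, le_trans (ENNReal.ofReal_le_ofReal ?_) hEm, hEx⟩
    have h2 : n + 1 ≤ 4 * ((n + 1) / 2) := by omega
    have h3 : ((n + 1 : ℕ) : ℝ) ≤ 4 * (((n + 1) / 2 : ℕ) : ℝ) := by exact_mod_cast h2
    have h4 : (0 : ℝ) < (n + 1 : ℕ) := by positivity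
    rw [mul_div_assoc', le_div_iff₀ h4]
    nlinarith
  classical
  have hex : ∀ n : ℕ, ∃ E : Set ℝ, MeasurableSet E ∧
      ((∃ E : Set ℝ, MeasurableSet E ∧
        ENNReal.ofReal (c / 4) ≤ volume.restrict (Ico 0 (b d)) E ∧
        ∀ x ∈ E, ∃ u, u ≤ x ∧ x ≤ u + c / (n + 1 : ℕ) ∧
          volume.real (A ∩ Ico u (u + c / (n + 1 : ℕ))) = c / (n + 1 : ℕ) / 2) →
        ENNReal.ofReal (c / 4) ≤ volume.restrict (Ico 0 (b d)) E) ∧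
      ∀ x ∈ E, ∃ u, u ≤ x ∧ x ≤ u + c / (n + 1 : ℕ) ∧
        volume.real (A ∩ Ico u (u + c / (n + 1 : ℕ))) = c / (n + 1 : ℕ) / 2 := by
    intro n
    by_cases hP : ∃ E : Set ℝ, MeasurableSet E ∧
        ENNReal.ofReal (c / 4) ≤ volume.restrict (Ico 0 (b d)) E ∧
        ∀ x ∈ E, ∃ u, u ≤ x ∧ x ≤ u + c / (n + 1 : ℕ) ∧
          volume.real (A ∩ Ico u (u + c / (n + 1 : ℕ))) = c / (n + 1 : ℕ) / 2
    · obtain ⟨E, hE, hEm, hEx⟩ := hP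
      exact ⟨E, hE, fun _ => hEm, hEx⟩
    · exact ⟨∅, MeasurableSet.empty, fun h' => absurd h' hP, fun x hx => hx.elim⟩
  choose E hE hEm hEx using hex
  have hS := le_measure_frequently (μ := volume.restrict (Ico 0 (b d))) hE
    (hfreq.mono fun n hn => hEm n hn)
  have hnull : volume.restrict (Ico 0 (b d)) {x | ∃ᶠ n in atTop, x ∈ E n} = 0 := by
    rw [measure_eq_zero_iff_ae_notMem]
    refine ae_restrict_of_ae ?_
    have hdA := (ae_restrict_iff' hA).1 (ae_tendsto_density A)
    have hdA' := (ae_restrict_iff' hA.compl).1 (ae_tendsto_density Aᶜ)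
    filter_upwards [hdA, hdA'] with x hx hx' hxS
    have hxS' : ∃ᶠ n in atTop, x ∈ E n := hxS
    choose! u hu1 hu2 hu3 using fun n (hn : x ∈ E n) => hEx n x hn
    have : (atTop ⊓ 𝓟 {n | x ∈ E n}).NeBot := frequently_mem_iff_neBot.1 hxS'
    have hev : ∀ᶠ n in atTop ⊓ 𝓟 {n | x ∈ E n}, x ∈ E n := eventually_inf_principal.2
      (Eventually.of_forall fun n hn => hn)
    have hlim := hRlim.mono_left (inf_le_left (b := 𝓟 {n | x ∈ E n}))
    by_cases hxA : x ∈ A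
    · have h2 := hx hxA u _ hlim (hev.mono fun n hn => ⟨hu1 n hn, hu2 n hn⟩)
      have h3 := tendsto_nhds_unique (h2.congr' (hev.mono fun n hn => by
        rw [hu3 n hn, div_div_cancel_left' (by positivity)])) tendsto_const_nhds
      norm_num at h3
    · have h2 := hx' hxA u _ hlim (hev.mono fun n hn => ⟨hu1 n hn, hu2 n hn⟩)
      have h3 := tendsto_nhds_unique (h2.congr' (hev.mono fun n hn => by
        have h4 := volume_real_inter_Ico_add_compl hA (u := u n)
          (show 0 ≤ c / (n + 1 : ℕ) by positivity)
        rw [hu3 n hn] at h4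
        rw [show volume.real (Aᶜ ∩ Ico (u n) (u n + c / (n + 1 : ℕ))) = c / (n + 1 : ℕ) / 2 by
          linarith, div_div_cancel_left' (by positivity)])) tendsto_const_nhds
      norm_num at h3
  rw [hnull] at hS
  exact absurd hS (not_le.2 (ENNReal.ofReal_pos.2 (by positivity)))

theorem eq_normalized_volume (h : GenericIET d b T) (hm : Measurable T) {c : ℝ} (hc : 0 < c)
    (hF : ∃ᶠ n : ℕ in atTop, FreeCover d b T (n + 1) (c / (n + 1 : ℕ)))
    {ν : Measure ℝ} [IsProbabilityMeasure ν]
    (hν : Measure.map T ν = ν) (hν0 : ν (Ico 0 (b d))ᶜ = 0) :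
    ν = (volume (Ico 0 (b d)))⁻¹ • volume.restrict (Ico 0 (b d)) := by
  have hmp : MeasurePreserving T ν ν := ⟨hm, hν⟩
  have hac : ν ≪ volume := absolutelyContinuous_volume_of_Ioc_le (C := 4 / c) (by positivity)
    fun u v huv => h.measure_Ioc_le_mul hc hF hmp hν0 huv
  have hac' : ν ≪ volume.restrict (Ico 0 (b d)) := by
    intro s hs
    rw [Measure.restrict_apply' measurableSet_Ico] at hs
    rw [← measure_inter_conull hν0]
    exact hac hs
  obtain ⟨e, he⟩ := (h.ergodic hm hc hF).eq_smul_of_absolutelyContinuous hmp hac'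
  have h1 : e * volume (Ico 0 (b d)) = 1 := by
    have := congrArg (fun m : Measure ℝ => m univ) he
    simpa using this.symm
  rw [ENNReal.eq_inv_of_mul_eq_one_left h1] at he
  exact he

end GenericIET

/-- Theorem: Mahler's question for the curve `(x, x², …, x^d)`.
For `d ≥ 2` and `σ(i) = d + 1 - i` (zero-indexed: `σ(i) = d - 1 - i`), for Lebesgue-a.e.
`x > 0` the interval exchange `T_σ(x, x², …, x^d)` is uniquely ergodic. -/
theorem mahler_curve_uniquely_ergodic (d : ℕ) (hd : 2 ≤ d) (σ : Equiv.Perm (Fin d))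
    (hσ : ∀ i : Fin d, (σ i : ℕ) = d - 1 - (i : ℕ)) :
    ∀ᵐ x ∂(volume : Measure ℝ), 0 < x →
      UniquelyErgodicIET d σ (fun i : Fin d => x ^ ((i : ℕ) + 1)) := by
  have hT : ∀ x, 0 < x → ReversingIET d (powSum x) (iet d σ (fun i : Fin d => x ^ ((i : ℕ) + 1))) :=
    fun x hx => reversingIET_iet hd σ hσ hx
  have hm : ∀ x, 0 < x → Measurable (iet d σ (fun i : Fin d => x ^ ((i : ℕ) + 1))) :=
    fun x hx => measurable_iet_pow hd σ hσ hx
  filter_upwards [ae_exists_frequently_freeCover hd _ hT hm] with x hx hx0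
  obtain ⟨hgen, c, hc, hF⟩ := hx hx0
  have hI : ietInterval d (fun i : Fin d => x ^ ((i : ℕ) + 1)) = Ico 0 (powSum x d) := by
    rw [ietInterval, partialSum_pow x le_rfl]
  intro μ hμ hμ0 hμT
  rw [hI] at hμ0 ⊢
  exact hgen.eq_normalized_volume (hm x hx0) hc hF hμT hμ0
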